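/- arXiv:math/9811040 — 5 statements merged into one kernel-verified Lean document; each statement's English description precedes it below -/
import Mathlib

section
/- Let φ : ℝ → ℂ be a smooth function with compact support contained in ℝ ∖ {0}, and define the inversion Iφ(t) = |t|^{−1}·φ(1/t) for t ≠ 0, Iφ(0) = 0 (so Iφ is again smooth with compact support in ℝ ∖ {0}). Then for every t ≠ 0, H(Iφ)(t) = |t|^{−1}·H(φ)(1/t). (The conductor operator commutes with the inversion I.) -/
open MeasureTheory Complex

/-- The inverse Fourier transform on `ℝ`: `𝓕⁻¹f(x) = ∫ f(ξ)·e^{2πixξ} dξ`. -/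
noncomputable def fourierInv (f : ℝ → ℂ) (x : ℝ) : ℂ :=
  ∫ ξ : ℝ, f ξ * Complex.exp (2 * Real.pi * Complex.I * x * ξ)

/-- The conductor operator
`H(φ)(t) = log|t|·φ(t) + ∫ log|ξ|·(𝓕⁻¹φ)(ξ)·e^{−2πitξ} dξ`. -/
noncomputable def condOp (φ : ℝ → ℂ) (t : ℝ) : ℂ :=
  (Real.log |t| : ℂ) * φ t +
    ∫ ξ : ℝ, (Real.log |ξ| : ℂ) * fourierInv φ ξ *
      Complex.exp (-(2 * Real.pi * Complex.I * t * ξ))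


open scoped FourierTransform SchwartzMap
open Filter Topology Set

lemma schw (ψ : ℝ → ℂ) (h1 : ContDiff ℝ (⊤ : ℕ∞) ψ) (h2 : HasCompactSupport ψ) :
    ∃ g : 𝓢(ℝ, ℂ), (∀ ξ, fourierInv ψ ξ = g ξ) ∧ 𝓕 (g : ℝ → ℂ) = ψ := by
  refine ⟨𝓕⁻ (h2.toSchwartzMap h1), fun ξ => ?_, ?_⟩
  · rw [SchwartzMap.fourierInv_coe, Real.fourierInv_eq', fourierInv]
    congr 1
    ext v
    simp only [HasCompactSupport.toSchwartzMap_toFun, smul_eq_mul]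
    rw [mul_comm]
    congr 2
    simp
    ring
  · rw [← SchwartzMap.fourier_coe]
    simp
    rfl

lemma gauss_pair (g : 𝓢(ℝ, ℂ)) (ψ : ℝ → ℂ) (h : 𝓕 (g : ℝ → ℂ) = ψ) (μ : ℝ) (hμ : 0 < μ) :
    ∫ x : ℝ, ψ x * (Real.exp (-(Real.pi * x ^ 2 * μ)) : ℂ) =
      ((μ ^ (-(1/2) : ℝ) : ℝ) : ℂ) *
        ∫ ξ : ℝ, g ξ * (Real.exp (-(Real.pi * ξ ^ 2 * μ⁻¹)) : ℂ) := by
  have hb : 0 < (μ : ℂ).re := by simpa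
  have hG := fourier_gaussian_pi hb
  have hI : Integrable (fun x : ℝ => cexp (-Real.pi * μ * x ^ 2)) := by
    have := integrable_cexp_neg_mul_sq (b := (Real.pi * μ : ℂ)) (by
      rw [← ofReal_mul, ofReal_re]; positivity)
    simpa using this
  have key : ∫ ξ : ℝ, 𝓕 (fun x : ℝ => cexp (-Real.pi * μ * x ^ 2)) ξ • g ξ =
      ∫ x : ℝ, cexp (-Real.pi * μ * x ^ 2) • 𝓕 (g : ℝ → ℂ) x := by
    simpa using! VectorFourier.integral_fourierIntegral_smul_eq_flip (L := innerₗ ℝ)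
      (μ := volume) (ν := volume) Real.continuous_fourierChar continuous_inner hI g.integrable
  rw [hG, h] at key
  have e1 : ∫ x : ℝ, ψ x * (Real.exp (-(Real.pi * x ^ 2 * μ)) : ℂ) =
      ∫ x : ℝ, cexp (-Real.pi * μ * x ^ 2) • ψ x := by
    congr 1; ext x
    rw [smul_eq_mul, mul_comm]
    push_cast
    congr 2; ring
  rw [e1, ← key, ← integral_const_mul]
  congr 1; ext x
  simp only [smul_eq_mul]
  have e2 : (1 / (μ : ℂ) ^ (1 / 2 : ℂ)) = ((μ ^ (-(1/2) : ℝ) : ℝ) : ℂ) := by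
    rw [Complex.ofReal_cpow hμ.le]
    push_cast
    rw [Complex.cpow_neg, one_div]
  rw [e2]
  push_cast
  have e3 : (-Real.pi / μ * (x:ℂ) ^ 2 : ℂ) = -(Real.pi * x ^ 2 * (μ:ℂ)⁻¹) := by
    rw [div_eq_mul_inv]; ring
  rw [e3]; ring

lemma gam (b x : ℝ) (hb : 0 < b) (hx : x ≠ 0) :
    ∫ μ in Ioi (0:ℝ), μ ^ (b / 2 - 1) * Real.exp (-(Real.pi * x ^ 2 * μ)) =
      (Real.Gamma (b / 2) * Real.pi ^ (-(b / 2))) * |x| ^ (-b) := by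
  have hp : 0 < Real.pi := Real.pi_pos
  have hx2 : 0 < |x| := abs_pos.mpr hx
  rw [Real.integral_rpow_mul_exp_neg_mul_Ioi (by positivity) (by positivity), one_div,
    Real.inv_rpow (by positivity), Real.mul_rpow (by positivity) (by positivity), mul_inv,
    ← Real.rpow_neg hp.le, ← sq_abs, ← Real.rpow_natCast, ← Real.rpow_mul hx2.le,
    ← Real.rpow_neg hx2.le]
  have : -((2:ℕ) * (b / 2)) = -b := by push_cast; ring
  rw [this]; ring

lemma mellin_gauss (h : ℝ → ℂ) (hcont : Continuous h) (b : ℝ) (hb : 0 < b)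
    (hInt : Integrable (fun x : ℝ => ((|x| ^ (-b) : ℝ) : ℂ) * h x)) :
    ∫ μ in Ioi (0:ℝ), ((μ ^ (b / 2 - 1) : ℝ) : ℂ) *
        ∫ x : ℝ, h x * (Real.exp (-(Real.pi * x ^ 2 * μ)) : ℂ) =
      ((Real.Gamma (b / 2) * Real.pi ^ (-(b / 2)) : ℝ) : ℂ) *
        ∫ x : ℝ, ((|x| ^ (-b) : ℝ) : ℂ) * h x := by
  have hp : 0 < Real.pi := Real.pi_pos
  have hne : ∀ᵐ x : ℝ, x ≠ 0 := by
    rw [ae_iff]; simp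
  have eqn : ∀ x μ : ℝ, 0 < μ → ‖((μ ^ (b / 2 - 1) : ℝ) : ℂ) *
      (h x * (Real.exp (-(Real.pi * x ^ 2 * μ)) : ℂ))‖ =
      ‖h x‖ * (μ ^ (b / 2 - 1) * Real.exp (-(Real.pi * x ^ 2 * μ))) := by
    intro x μ hμ
    rw [norm_mul, norm_mul, Complex.norm_real, Complex.norm_real, Real.norm_of_nonneg (by positivity),
      Real.norm_of_nonneg (by positivity)]
    ring
  have hg : ∀ x : ℝ, x ≠ 0 → IntegrableOn
      (fun μ : ℝ => μ ^ (b / 2 - 1) * Real.exp (-(Real.pi * x ^ 2 * μ))) (Ioi 0) := by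
    intro x hx
    by_contra hcon
    have h0 := integral_undef hcon
    rw [gam b x hb hx] at h0
    have hx2 : 0 < |x| := abs_pos.mpr hx
    have := Real.Gamma_pos_of_pos (half_pos hb)
    have : 0 < (Real.Gamma (b / 2) * Real.pi ^ (-(b / 2))) * |x| ^ (-b) := by positivity
    linarith
  simp_rw [← integral_const_mul]
  have hI : Integrable (Function.uncurry (fun (x μ : ℝ) => ((μ ^ (b / 2 - 1) : ℝ) : ℂ) *
      (h x * (Real.exp (-(Real.pi * x ^ 2 * μ)) : ℂ))))
      ((volume : Measure ℝ).prod (volume.restrict (Ioi (0:ℝ)))) := by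
    rw [integrable_prod_iff]
    · constructor
      · filter_upwards [hne] with x hx
        have := ((hg x hx).ofReal (𝕜 := ℂ)).const_mul (h x)
        refine this.congr (Eventually.of_forall fun μ => ?_)
        simp [Function.uncurry]
        ring
      · refine (hInt.norm.const_mul (Real.Gamma (b / 2) * Real.pi ^ (-(b / 2)))).congr ?_
        filter_upwards [hne] with x hx
        simp only [Function.uncurry]
        rw [setIntegral_congr_fun measurableSet_Ioi (fun μ hμ => eqn x μ hμ), integral_const_mul,
          gam b x hb hx, norm_mul, Complex.norm_real, Real.norm_of_nonneg (by positivity)]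
        ring
    · apply Measurable.aestronglyMeasurable
      change Measurable (fun p : ℝ × ℝ => ((p.2 ^ (b / 2 - 1) : ℝ) : ℂ) *
        (h p.1 * (Real.exp (-(Real.pi * p.1 ^ 2 * p.2)) : ℂ)))
      have := hcont.measurable
      fun_prop
  rw [← integral_integral_swap hI]
  apply integral_congr_ae
  filter_upwards [hne] with x hx
  have : ∀ μ : ℝ, ((μ ^ (b / 2 - 1) : ℝ) : ℂ) *
      (h x * (Real.exp (-(Real.pi * x ^ 2 * μ)) : ℂ)) = h x *
      ((μ ^ (b / 2 - 1) * Real.exp (-(Real.pi * x ^ 2 * μ)) : ℝ) : ℂ) := by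
    intro μ; push_cast; ring
  simp_rw [this]
  rw [integral_const_mul, integral_complex_ofReal, gam b x hb hx]
  push_cast; ring

lemma int_rpow (h : 𝓢(ℝ, ℂ)) (b : ℝ) (hb : 0 < b) (hb1 : b < 1) :
    Integrable (fun x : ℝ => ((|x| ^ (-b) : ℝ) : ℂ) * h x) := by
  have hm : Measurable (fun x : ℝ => ((|x| ^ (-b) : ℝ) : ℂ)) := by fun_prop
  obtain ⟨M, hM'⟩ : ∃ M, ∀ x, ‖h x‖ ≤ M :=
    ⟨_, fun x => h.toBoundedContinuousFunction.norm_coe_le_norm x⟩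
  have h1 : IntegrableOn (fun x : ℝ => ((|x| ^ (-b) : ℝ) : ℂ)) (Metric.ball 0 1) := by
    refine integrableOn_ball_of_norm_le_rpow (C := 1) (α := b) (by simp) (by simpa using hb1)
      ?_ ?_
    · refine Eventually.of_forall fun x => ?_
      rw [Complex.norm_real, Real.norm_of_nonneg (by positivity), Real.norm_eq_abs, one_mul]
    · exact hm.aestronglyMeasurable
  have h2 : IntegrableOn (fun x : ℝ => ((|x| ^ (-b) : ℝ) : ℂ) * h x) (Metric.ball 0 1) :=
    h1.mul_bdd (c := M) h.continuous.aestronglyMeasurable (Eventually.of_forall hM')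
  have h3 : IntegrableOn (fun x : ℝ => ((|x| ^ (-b) : ℝ) : ℂ) * h x) (Metric.ball 0 1)ᶜ := by
    refine Integrable.bdd_mul (c := 1) h.integrable.integrableOn hm.aestronglyMeasurable ?_
    refine (ae_restrict_iff' Metric.isOpen_ball.measurableSet.compl).mpr
      (Eventually.of_forall fun x hx => ?_)
    rw [Complex.norm_real, Real.norm_of_nonneg (by positivity)]
    apply Real.rpow_le_one_of_one_le_of_nonpos _ (by linarith)
    simpa using hx
  have := h2.union h3
  rwa [union_compl_self, integrableOn_univ] at this

/-- The constant in the Fourier transform of `|ξ|^(-a)`. -/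
noncomputable def rieszConst (a : ℝ) : ℝ :=
  Real.Gamma ((1 - a) / 2) * Real.pi ^ (-((1 - a) / 2)) /
    (Real.Gamma (a / 2) * Real.pi ^ (-(a / 2)))

lemma riesz (g ψs : 𝓢(ℝ, ℂ)) (h : 𝓕 (g : ℝ → ℂ) = ψs) (a : ℝ) (ha : 0 < a) (ha1 : a < 1) :
    ∫ ξ : ℝ, ((|ξ| ^ (-a) : ℝ) : ℂ) * g ξ =
      (rieszConst a : ℂ) * ∫ x : ℝ, ((|x| ^ (-(1 - a)) : ℝ) : ℂ) * ψs x := by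
  have hp : 0 < Real.pi := Real.pi_pos
  have A := mellin_gauss g g.continuous a ha (int_rpow g a ha ha1)
  have B := mellin_gauss ψs ψs.continuous (1 - a) (by linarith)
    (int_rpow ψs (1 - a) (by linarith) (by linarith))
  have C := integral_comp_rpow_Ioi (fun μ : ℝ => ((μ ^ (a / 2 - 1) : ℝ) : ℂ) *
        ∫ x : ℝ, g x * (Real.exp (-(Real.pi * x ^ 2 * μ)) : ℂ)) (p := -1) (by norm_num)
  have e : ∫ μ in Ioi (0:ℝ), ((μ ^ ((1 - a) / 2 - 1) : ℝ) : ℂ) *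
        ∫ x : ℝ, ψs x * (Real.exp (-(Real.pi * x ^ 2 * μ)) : ℂ) =
      ∫ μ in Ioi (0:ℝ), ((μ ^ (a / 2 - 1) : ℝ) : ℂ) *
        ∫ x : ℝ, g x * (Real.exp (-(Real.pi * x ^ 2 * μ)) : ℂ) := by
    rw [← C]
    refine setIntegral_congr_fun measurableSet_Ioi fun μ hμ => ?_
    have hμ : 0 < μ := hμ
    rw [gauss_pair g ψs h μ hμ, Real.rpow_neg_one, Complex.real_smul, ← mul_assoc, ← mul_assoc,
      ← Complex.ofReal_mul, ← Complex.ofReal_mul, ← Real.rpow_add hμ]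
    congr 2
    rw [← Real.rpow_neg_one, ← Real.rpow_mul hμ.le, abs_neg, abs_one, one_mul, ← Real.rpow_add hμ]
    congr 1; ring
  rw [e, A] at B
  have h1 : (Real.Gamma (a / 2) * Real.pi ^ (-(a / 2))) ≠ 0 := by
    have := Real.Gamma_pos_of_pos (half_pos ha)
    positivity
  have h1' : ((Real.Gamma (a / 2) * Real.pi ^ (-(a / 2)) : ℝ) : ℂ) ≠ 0 := by exact_mod_cast h1
  rw [rieszConst, Complex.ofReal_div, div_mul_eq_mul_div, eq_div_iff h1', mul_comm, B]

lemma gamma_aux (s : ℝ) (hs : 0 < s) (m : ℕ) : s ≠ -m := by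
  have : (0:ℝ) ≤ m := Nat.cast_nonneg m
  intro h; linarith

lemma rieszConst_lim : ∃ c : ℝ, Tendsto (fun a => rieszConst a / a) (𝓝[>] 0) (𝓝 c) := by
  have hp : Real.pi ≠ 0 := Real.pi_ne_zero
  have hc : ContinuousAt (fun a : ℝ => Real.Gamma ((1 - a) / 2) * Real.pi ^ (-((1 - a) / 2)) /
    (2 * Real.Gamma (a / 2 + 1) * Real.pi ^ (-(a / 2)))) 0 := by
    have g1 : ContinuousAt Real.Gamma ((1 - 0) / 2) :=
      (Real.differentiableAt_Gamma (gamma_aux _ (by norm_num))).continuousAt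
    have g2 : ContinuousAt Real.Gamma (0 / 2 + 1) :=
      (Real.differentiableAt_Gamma (gamma_aux _ (by norm_num))).continuousAt
    have g1' : ContinuousAt (fun a : ℝ => Real.Gamma ((1 - a) / 2)) 0 :=
      ContinuousAt.comp (f := fun a : ℝ => (1 - a) / 2) g1 (by fun_prop)
    have g2' : ContinuousAt (fun a : ℝ => Real.Gamma (a / 2 + 1)) 0 :=
      ContinuousAt.comp (f := fun a : ℝ => a / 2 + 1) g2 (by fun_prop)
    have p1 : ContinuousAt (fun a : ℝ => Real.pi ^ (-((1 - a) / 2))) 0 :=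
      (Real.continuous_const_rpow hp).continuousAt.comp (by fun_prop)
    have p2 : ContinuousAt (fun a : ℝ => Real.pi ^ (-(a / 2))) 0 :=
      (Real.continuous_const_rpow hp).continuousAt.comp (by fun_prop)
    refine (g1'.mul p1).div ((g2'.const_mul 2).mul p2) ?_
    simp
  refine ⟨_, (hc.tendsto.mono_left nhdsWithin_le_nhds).congr' ?_⟩
  filter_upwards [self_mem_nhdsWithin] with a ha
  have ha : 0 < a := ha
  rw [Real.Gamma_add_one (by positivity), rieszConst, div_div]
  congr 1
  ring

lemma log_bound (y a : ℝ) (hy : 0 < y) (ha : 0 < a) (ha1 : a ≤ 1 / 4) :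
    |(1 - y ^ (-a)) / a| ≤ y + 4 * y ^ (-(1 / 2) : ℝ) := by
  have q : 0 < y ^ (-(1 / 2) : ℝ) := by positivity
  rw [abs_le]
  constructor
  · rw [le_div_iff₀ ha]
    suffices y ^ (-a) - 1 ≤ a * (4 * y ^ (-(1 / 2) : ℝ)) by nlinarith
    rcases le_total 1 y with h1 | h1
    · have := Real.rpow_le_one_of_one_le_of_nonpos h1 (neg_nonpos.mpr ha.le)
      have : 0 ≤ a * (4 * y ^ (-(1 / 2) : ℝ)) := by positivity
      linarith
    · have e1 : 1 - y ^ a ≤ a * Real.log y⁻¹ := by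
        rw [Real.rpow_def_of_pos hy, Real.log_inv]
        have := Real.add_one_le_exp (Real.log y * a)
        linarith
      have e2 : Real.log y⁻¹ ≤ 4 * y ^ (-(1 / 4) : ℝ) := by
        have := Real.log_le_rpow_div (x := y⁻¹) (ε := 1 / 4) (by positivity) (by norm_num)
        rw [Real.inv_rpow hy.le, ← Real.rpow_neg hy.le] at this
        linarith
      have e3 : y ^ (-a) ≤ y ^ (-(1 / 4) : ℝ) :=
        Real.rpow_le_rpow_of_exponent_ge hy h1 (by linarith)
      have e4 : y ^ (-a) - 1 = y ^ (-a) * (1 - y ^ a) := by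
        rw [mul_sub, ← Real.rpow_add hy]; simp
      have e5 : y ^ (-(1 / 2) : ℝ) = y ^ (-(1 / 4) : ℝ) * y ^ (-(1 / 4) : ℝ) := by
        rw [← Real.rpow_add hy]; norm_num
      rw [e4, e5]
      calc y ^ (-a) * (1 - y ^ a) ≤ y ^ (-a) * (a * (4 * y ^ (-(1 / 4) : ℝ))) := by
            gcongr
            exact e1.trans (by gcongr)
        _ ≤ y ^ (-(1 / 4) : ℝ) * (a * (4 * y ^ (-(1 / 4) : ℝ))) := by gcongr
        _ = _ := by ring
  · rw [div_le_iff₀ ha, Real.rpow_def_of_pos hy]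
    have e1 := Real.add_one_le_exp (Real.log y * -a)
    have e2 := Real.log_le_sub_one_of_pos hy
    have : 0 ≤ a * (4 * y ^ (-(1 / 2) : ℝ)) := by positivity
    nlinarith

lemma log_lim (y : ℝ) (hy : 0 < y) :
    Tendsto (fun a : ℝ => (1 - y ^ (-a)) / a) (𝓝[>] 0) (𝓝 (Real.log y)) := by
  have h : HasDerivAt (fun a : ℝ => 1 - y ^ (-a)) (Real.log y) 0 := by
    have := ((hasDerivAt_neg (0:ℝ)).const_rpow (a := y) hy).const_sub 1
    simpa using this
  have := h.tendsto_slope_zero_right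
  refine this.congr fun a => ?_
  simp [div_eq_inv_mul]

lemma log_int_lim (g : 𝓢(ℝ, ℂ)) :
    Tendsto (fun a : ℝ => (1 / (a : ℂ)) * ((∫ ξ, g ξ) - ∫ ξ : ℝ, ((|ξ| ^ (-a) : ℝ) : ℂ) * g ξ))
      (𝓝[>] 0) (𝓝 (∫ ξ : ℝ, (Real.log |ξ| : ℂ) * g ξ)) := by
  have hne : ∀ᵐ x : ℝ, x ≠ 0 := by
    rw [ae_iff]; simp
  have hmem : ∀ᶠ a : ℝ in 𝓝[>] 0, 0 < a ∧ a ≤ 1 / 4 := by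
    filter_upwards [Ioc_mem_nhdsGT (show (0:ℝ) < 1 / 4 by norm_num)] with a ha using ha
  have key : Tendsto (fun a : ℝ => ∫ ξ : ℝ, (((1 - |ξ| ^ (-a)) / a : ℝ) : ℂ) * g ξ)
      (𝓝[>] 0) (𝓝 (∫ ξ : ℝ, (Real.log |ξ| : ℂ) * g ξ)) := by
    refine tendsto_integral_filter_of_dominated_convergence
      (fun ξ => (|ξ| + 4 * |ξ| ^ (-(1 / 2) : ℝ)) * ‖g ξ‖) ?_ ?_ ?_ ?_
    · refine Eventually.of_forall fun a => ?_
      have : Measurable (fun ξ : ℝ => (((1 - |ξ| ^ (-a)) / a : ℝ) : ℂ)) := by fun_prop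
      exact this.aestronglyMeasurable.mul g.continuous.aestronglyMeasurable
    · filter_upwards [hmem] with a ha
      filter_upwards [hne] with ξ hξ
      rw [norm_mul, Complex.norm_real, Real.norm_eq_abs]
      gcongr
      exact log_bound _ a (abs_pos.mpr hξ) ha.1 ha.2
    · have i1 := g.integrable_pow_mul volume 1
      have i2 := ((int_rpow g (1 / 2) (by norm_num) (by norm_num)).norm).const_mul 4
      refine (i1.add i2).congr (Eventually.of_forall fun ξ => ?_)
      simp only [Pi.add_apply, norm_mul, Complex.norm_real, pow_one, Real.norm_eq_abs]
      rw [abs_of_nonneg (by positivity : 0 ≤ |ξ| ^ (-(1 / 2) : ℝ))]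
      ring
    · filter_upwards [hne] with ξ hξ
      exact ((Complex.continuous_ofReal.tendsto _).comp (log_lim _ (abs_pos.mpr hξ))).mul_const _
  refine key.congr' ?_
  filter_upwards [hmem] with a ha
  rw [← integral_sub g.integrable (int_rpow g a ha.1 (by linarith [ha.2])), ← integral_const_mul]
  congr 1; ext ξ
  push_cast
  ring

lemma fourierInv_shift (φ : ℝ → ℂ) (t ξ : ℝ) :
    fourierInv (fun x => φ (t + x)) ξ =
      fourierInv φ ξ * Complex.exp (-(2 * Real.pi * Complex.I * t * ξ)) := by
  unfold fourierInv
  rw [← integral_add_left_eq_self (fun x : ℝ => φ x * Complex.exp (2 * Real.pi * Complex.I * ξ * x)) t,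
    ← integral_mul_const]
  congr 1; ext x
  beta_reduce
  rw [mul_assoc (φ (t + x)), ← Complex.exp_add]
  congr 2
  push_cast
  ring

lemma cond_lim (φ : ℝ → ℂ) (h1 : ContDiff ℝ (⊤ : ℕ∞) φ) (h2 : HasCompactSupport φ) (t : ℝ) :
    Tendsto (fun a : ℝ => (1 / (a : ℂ)) * (φ t - (rieszConst a : ℂ) *
        ∫ r : ℝ, ((|r - t| ^ (-(1 - a)) : ℝ) : ℂ) * φ r))
      (𝓝[>] 0) (𝓝 (condOp φ t - (Real.log |t| : ℂ) * φ t)) := by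
  have s1 : ContDiff ℝ (⊤ : ℕ∞) (fun x => φ (t + x)) := h1.comp (contDiff_const.add contDiff_id)
  have s2 : HasCompactSupport (fun x => φ (t + x)) :=
    h2.comp_homeomorph (Homeomorph.addLeft t)
  obtain ⟨g, hg, hF⟩ := schw _ s1 s2
  have e0 : ∫ ξ, g ξ = φ t := by
    have := congrFun hF 0
    rw [Real.fourier_real_eq_integral_exp_smul] at this
    simpa using this
  have e1 : condOp φ t - (Real.log |t| : ℂ) * φ t = ∫ ξ : ℝ, (Real.log |ξ| : ℂ) * g ξ := by
    rw [condOp, add_sub_cancel_left]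
    congr 1; ext ξ
    rw [← hg, fourierInv_shift, mul_assoc]
  rw [e1]
  refine (log_int_lim g).congr' ?_
  filter_upwards [Ioo_mem_nhdsGT (show (0:ℝ) < 1 by norm_num)] with a ha
  rw [e0, riesz g (s2.toSchwartzMap s1) hF a ha.1 ha.2,
    ← integral_add_left_eq_self (fun r : ℝ => ((|r - t| ^ (-(1 - a)) : ℝ) : ℂ) * φ r) t]
  simp

lemma away (φ : ℝ → ℂ) (hsupp : tsupport φ ⊆ {s : ℝ | s ≠ 0}) :
    ∃ δ > 0, ∀ r : ℝ, |r| < δ → φ r = 0 := by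
  have h0 : (0:ℝ) ∈ (tsupport φ)ᶜ := fun h => hsupp h rfl
  obtain ⟨δ, hδ, hb⟩ := Metric.isOpen_iff.mp (isClosed_tsupport φ).isOpen_compl 0 h0
  refine ⟨δ, hδ, fun r hr => ?_⟩
  exact image_eq_zero_of_notMem_tsupport (hb (by simpa using hr))

lemma inv_smooth (φ : ℝ → ℂ)
    (hφ : ContDiff ℝ (⊤ : ℕ∞) φ) (hc : HasCompactSupport φ)  :
    ContDiff ℝ (⊤ : ℕ∞) (fun s : ℝ => if s = 0 then 0 else ((|s|⁻¹ : ℝ) : ℂ) * φ s⁻¹) := by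
  rw [contDiff_iff_contDiffAt]
  intro s
  by_cases hs : s = 0
  · subst hs
    obtain ⟨R, hR, hRb⟩ := hc.isCompact.isBounded.exists_pos_norm_lt
    have : (fun s : ℝ => if s = 0 then 0 else ((|s|⁻¹ : ℝ) : ℂ) * φ s⁻¹) =ᶠ[𝓝 0] fun _ => 0 := by
      filter_upwards [Metric.ball_mem_nhds (0:ℝ) (inv_pos.mpr hR)] with s hs
      split_ifs with h
      · rfl
      · suffices φ s⁻¹ = 0 by rw [this, mul_zero]
        apply image_eq_zero_of_notMem_tsupport
        intro hmem
        have h3 := hRb _ hmem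
        rw [norm_inv, Real.norm_eq_abs] at h3
        have h4 : |s| < R⁻¹ := by simpa using hs
        have h5 := (lt_inv_comm₀ (abs_pos.mpr h) hR).mp h4
        linarith
    exact contDiffAt_const.congr_of_eventuallyEq this
  · have : (fun s : ℝ => if s = 0 then 0 else ((|s|⁻¹ : ℝ) : ℂ) * φ s⁻¹) =ᶠ[𝓝 s]
        fun s => ((|s|⁻¹ : ℝ) : ℂ) * φ s⁻¹ := by
      filter_upwards [isOpen_ne.mem_nhds hs] with x hx
      simp [show x ≠ 0 from hx]
    refine ContDiffAt.congr_of_eventuallyEq ?_ this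
    have a1 : ContDiffAt ℝ (⊤ : ℕ∞) (fun s : ℝ => |s|⁻¹) s :=
      (contDiffAt_abs hs).inv (abs_ne_zero.mpr hs)
    have a2 : ContDiffAt ℝ (⊤ : ℕ∞) (fun s : ℝ => φ s⁻¹) s :=
      hφ.contDiffAt.comp s (contDiffAt_inv ℝ hs)
    exact (Complex.ofRealCLM.contDiff.contDiffAt.comp s a1).mul a2

lemma inv_supp (φ : ℝ → ℂ) (hsupp : tsupport φ ⊆ {s : ℝ | s ≠ 0}) :
    HasCompactSupport (fun s : ℝ => if s = 0 then 0 else ((|s|⁻¹ : ℝ) : ℂ) * φ s⁻¹) := by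
  obtain ⟨δ, hδ, h⟩ := away φ hsupp
  refine HasCompactSupport.intro (isCompact_closedBall 0 δ⁻¹) fun x hx => ?_
  split_ifs with h0
  · rfl
  · rw [h, mul_zero]
    have : δ⁻¹ < |x| := by simpa using hx
    rw [abs_inv]
    exact (inv_lt_comm₀ hδ (abs_pos.mpr h0)).mp this

lemma inv_change (φ : ℝ → ℂ) (t : ℝ) (ht : t ≠ 0) (a : ℝ) :
    ∫ s : ℝ, ((|s - t| ^ (-(1 - a)) : ℝ) : ℂ) *
        (if s = 0 then 0 else ((|s|⁻¹ : ℝ) : ℂ) * φ s⁻¹) =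
      ((|t| ^ (-(1 - a)) : ℝ) : ℂ) * ∫ r : ℝ, ((|r - t⁻¹| ^ (-(1 - a)) * |r| ^ (-a) : ℝ) : ℂ) * φ r := by
  have hne : ∀ᵐ x : ℝ, x ∈ ({0}ᶜ : Set ℝ) := by
    rw [ae_iff]; simp
  have him : (fun x : ℝ => x⁻¹) '' ({0}ᶜ : Set ℝ) = {0}ᶜ := by
    ext x
    simp only [mem_image, mem_compl_iff, mem_singleton_iff]
    exact ⟨fun ⟨y, hy, h⟩ => h ▸ inv_ne_zero hy, fun h => ⟨x⁻¹, inv_ne_zero h, inv_inv x⟩⟩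
  have hcv := integral_image_eq_integral_abs_deriv_smul (s := ({0}ᶜ : Set ℝ))
    (f := fun x : ℝ => x⁻¹) (f' := fun x => -(x ^ 2)⁻¹) (measurableSet_singleton 0).compl
    (fun x hx => (hasDerivAt_inv hx).hasDerivWithinAt) (inv_injective.injOn)
    (fun r : ℝ => ((|t| ^ (-(1 - a)) : ℝ) : ℂ) *
      (((|r - t⁻¹| ^ (-(1 - a)) * |r| ^ (-a) : ℝ) : ℂ) * φ r))
  rw [him, setIntegral_eq_integral_of_ae_compl_eq_zero, integral_const_mul] at hcv
  · rw [hcv, ← setIntegral_eq_integral_of_ae_compl_eq_zero (s := ({0}ᶜ : Set ℝ))]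
    · refine setIntegral_congr_fun (measurableSet_singleton 0).compl fun s hs => ?_
      have hs : s ≠ 0 := hs
      have hs' : 0 < |s| := abs_pos.mpr hs
      have ht' : 0 < |t| := abs_pos.mpr ht
      have e1 : |s⁻¹ - t⁻¹| = |s - t| * |s|⁻¹ * |t|⁻¹ := by
        rw [abs_sub_comm s t, ← abs_inv, ← abs_inv, ← abs_mul, ← abs_mul]
        congr 1; field_simp
      have e2 : |s - t| ^ (-(1 - a)) * |s|⁻¹ =
          |(-(s ^ 2)⁻¹)| * (|t| ^ (-(1 - a)) * (|s⁻¹ - t⁻¹| ^ (-(1 - a)) * |s⁻¹| ^ (-a))) := by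
        rw [e1, Real.mul_rpow (by positivity) (by positivity),
          Real.mul_rpow (by positivity) (by positivity), abs_neg, abs_inv, abs_inv, abs_pow,
          Real.inv_rpow hs'.le, Real.inv_rpow hs'.le, Real.inv_rpow ht'.le]
        rw [← Real.rpow_neg hs'.le, ← Real.rpow_neg hs'.le]
        have q : |s| ^ (-(-(1 - a))) * |s| ^ (-(-a)) = |s| := by
          rw [← Real.rpow_add hs']; simp
        have q2 : |t| ^ (-(1 - a)) ≠ 0 := by positivity
        calc _ = |s - t| ^ (-(1 - a)) * ((|s| ^ 2)⁻¹ * |s|) := by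
              congr 1; field_simp
          _ = |s - t| ^ (-(1 - a)) * ((|s| ^ 2)⁻¹ * (|s| ^ (-(-(1 - a))) * |s| ^ (-(-a)))) := by
              rw [q]
          _ = _ := by field_simp
      simp only [if_neg hs, Complex.real_smul]
      rw [← mul_assoc, ← Complex.ofReal_mul, e2]
      push_cast
      ring
    · filter_upwards [hne] with x hx h using absurd hx h
  · filter_upwards [hne] with x hx h using absurd hx h

lemma rpow_lip (δ a u v : ℝ) (hδ : 0 < δ) (hδ1 : δ ≤ 1) (ha : 0 < a) (ha1 : a ≤ 1)
    (hu : δ ≤ u) (hv : δ ≤ v) :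
    |u ^ (-a) - v ^ (-a)| ≤ δ ^ (-2 : ℝ) * |u - v| := by
  have := Convex.norm_image_sub_le_of_norm_hasDerivWithin_le (s := Ici δ) (C := δ ^ (-2 : ℝ))
    (f := fun x : ℝ => x ^ (-a)) (f' := fun x => -a * x ^ (-a - 1)) (x := v) (y := u)
    (fun x hx => (Real.hasDerivAt_rpow_const (Or.inl (hδ.trans_le hx).ne')).hasDerivWithinAt)
    (fun x hx => ?_) (convex_Ici δ) hv hu
  · simpa using this
  · have hx : δ ≤ x := hx
    have hx0 : 0 < x := hδ.trans_le hx
    rw [norm_mul, norm_neg, Real.norm_of_nonneg ha.le, Real.norm_of_nonneg (by positivity)]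
    calc a * x ^ (-a - 1) ≤ 1 * δ ^ (-a - 1) := by
          gcongr ?_ * ?_
          exact Real.rpow_le_rpow_of_nonpos hδ hx (by linarith)
      _ ≤ _ := by
          rw [one_mul]
          exact Real.rpow_le_rpow_of_exponent_ge hδ hδ1 (by linarith)

lemma D_lim (φ : ℝ → ℂ) (hφ : Continuous φ) (hc : HasCompactSupport φ)
    (hsupp : tsupport φ ⊆ {s : ℝ | s ≠ 0}) (τ : ℝ) (hτ : τ ≠ 0) :
    Tendsto (fun a : ℝ => ∫ r : ℝ,
      ((|r - τ| ^ (-(1 - a)) * (|r| ^ (-a) - |τ| ^ (-a)) : ℝ) : ℂ) * φ r) (𝓝[>] 0) (𝓝 0) := by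
  obtain ⟨δ₀, hδ₀, h0⟩ := away φ hsupp
  set δ := min 1 (min δ₀ |τ|) with hδdef
  have hδ : 0 < δ := by
    have := abs_pos.mpr hτ
    positivity
  have hδ1 : δ ≤ 1 := min_le_left _ _
  have hδ2 : δ ≤ δ₀ := (min_le_right _ _).trans (min_le_left _ _)
  have hδ3 : δ ≤ |τ| := (min_le_right _ _).trans (min_le_right _ _)
  have hne : ∀ᵐ x : ℝ, x ≠ 0 := by
    rw [ae_iff]; simp
  have hne' : ∀ᵐ x : ℝ, x ≠ τ := by
    rw [ae_iff]; simp
  have hmem : ∀ᶠ a : ℝ in 𝓝[>] 0, 0 < a ∧ a ≤ 1 := by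
    filter_upwards [Ioc_mem_nhdsGT (show (0:ℝ) < 1 by norm_num)] with a ha using ha
  have hz : (0:ℂ) = ∫ r : ℝ, (0:ℂ) := by simp
  rw [hz]
  refine tendsto_integral_filter_of_dominated_convergence
      (fun r => δ ^ (-2 : ℝ) * (1 + |r - τ|) * ‖φ r‖) ?_ ?_ ?_ ?_
  · refine Eventually.of_forall fun a => ?_
    have : Measurable (fun r : ℝ =>
      ((|r - τ| ^ (-(1 - a)) * (|r| ^ (-a) - |τ| ^ (-a)) : ℝ) : ℂ)) := by fun_prop
    exact this.aestronglyMeasurable.mul hφ.aestronglyMeasurable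
  · filter_upwards [hmem] with a ha
    filter_upwards [hne'] with r hr
    by_cases hφr : φ r = 0
    · simp [hφr]
    have hr1 : δ ≤ |r| := by
      by_contra hcon
      exact hφr (h0 r (by linarith))
    have hd : 0 < |r - τ| := abs_pos.mpr (sub_ne_zero.mpr hr)
    rw [norm_mul, Complex.norm_real, Real.norm_eq_abs, abs_mul, abs_of_nonneg (by positivity : 0 ≤ |r - τ| ^ (-(1 - a)))]
    refine mul_le_mul_of_nonneg_right ?_ (norm_nonneg _)
    calc |r - τ| ^ (-(1 - a)) * |(|r| ^ (-a) - |τ| ^ (-a))|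
        ≤ |r - τ| ^ (-(1 - a)) * (δ ^ (-2 : ℝ) * |r - τ|) := by
          gcongr
          refine (rpow_lip δ a _ _ hδ hδ1 ha.1 ha.2 hr1 hδ3).trans ?_
          refine mul_le_mul_of_nonneg_left ?_ (by positivity)
          exact abs_abs_sub_abs_le_abs_sub r τ
      _ = δ ^ (-2 : ℝ) * |r - τ| ^ a := by
          have : |r - τ| ^ a = |r - τ| ^ (-(1 - a)) * |r - τ| := by
            nth_rewrite 3 [← Real.rpow_one |r - τ|]
            rw [← Real.rpow_add hd]; congr 1; ring
          rw [this]; ring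
      _ ≤ _ := by
          gcongr
          rcases le_total 1 |r - τ| with h | h
          · have := Real.rpow_le_rpow_of_exponent_le h ha.2
            rw [Real.rpow_one] at this
            linarith
          · have := Real.rpow_le_one hd.le h ha.1.le
            linarith
  · refine Continuous.integrable_of_hasCompactSupport (by fun_prop) ?_
    exact hc.norm.mul_left
  · filter_upwards [hne, hne'] with r hr hr'
    have hd : |r - τ| ≠ 0 := abs_ne_zero.mpr (sub_ne_zero.mpr hr')
    have hr2 : |r| ≠ 0 := abs_ne_zero.mpr hr
    have hτ2 : |τ| ≠ 0 := abs_ne_zero.mpr hτ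
    have c1 : Continuous (fun a : ℝ => |r - τ| ^ (-(1 - a))) :=
      (Real.continuous_const_rpow hd).comp (by fun_prop)
    have c2 : Continuous (fun a : ℝ => |r| ^ (-a)) :=
      (Real.continuous_const_rpow hr2).comp (by fun_prop)
    have c3 : Continuous (fun a : ℝ => |τ| ^ (-a)) :=
      (Real.continuous_const_rpow hτ2).comp (by fun_prop)
    have c : Continuous (fun a : ℝ =>
        ((|r - τ| ^ (-(1 - a)) * (|r| ^ (-a) - |τ| ^ (-a)) : ℝ) : ℂ) * φ r) := by fun_prop
    have := (c.tendsto 0).mono_left (nhdsWithin_le_nhds (s := Ioi 0))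
    simpa using this

lemma int_aux (φ : ℝ → ℂ) (h1 : ContDiff ℝ (⊤ : ℕ∞) φ) (h2 : HasCompactSupport φ) (τ a : ℝ)
    (ha : 0 < a) (ha1 : a < 1) :
    Integrable (fun r : ℝ => ((|r - τ| ^ (-(1 - a)) : ℝ) : ℂ) * φ r) := by
  have s1 : ContDiff ℝ (⊤ : ℕ∞) (fun x => φ (x + τ)) := h1.comp (contDiff_id.add contDiff_const)
  have s2 : HasCompactSupport (fun x => φ (x + τ)) :=
    h2.comp_homeomorph (Homeomorph.addRight τ)
  have := (int_rpow (s2.toSchwartzMap s1) (1 - a) (by linarith) (by linarith)).comp_sub_right τ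
  simpa using this

/-- The conductor operator commutes with the inversion `Iφ(t) = |t|⁻¹·φ(1/t)`:
for smooth `φ` compactly supported in `ℝ ∖ {0}` and `t ≠ 0`,
`H(Iφ)(t) = |t|⁻¹·H(φ)(1/t)`. -/
theorem conductor_commutes_with_inversion (φ : ℝ → ℂ)
    (hφ : ContDiff ℝ (⊤ : ℕ∞) φ) (hc : HasCompactSupport φ)
    (hsupp : tsupport φ ⊆ {s : ℝ | s ≠ 0}) (t : ℝ) (ht : t ≠ 0) :
    condOp (fun s => if s = 0 then 0 else ((|s|⁻¹ : ℝ) : ℂ) * φ s⁻¹) t =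
      ((|t|⁻¹ : ℝ) : ℂ) * condOp φ t⁻¹ := by
  have ht' : 0 < |t| := abs_pos.mpr ht
  have L1 := cond_lim _ (inv_smooth φ hφ hc) (inv_supp φ hsupp) t
  have L2 := cond_lim φ hφ hc t⁻¹
  have LD := D_lim φ hφ.continuous hc hsupp t⁻¹ (inv_ne_zero ht)
  obtain ⟨c, hcl⟩ := rieszConst_lim
  have hcl' : Tendsto (fun a : ℝ => ((rieszConst a / a : ℝ) : ℂ)) (𝓝[>] 0) (𝓝 (c : ℂ)) :=
    (Complex.continuous_ofReal.tendsto _).comp hcl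
  have hlog : Tendsto (fun a : ℝ => ((((1 - (|t| ^ (-2 : ℝ)) ^ (-a)) / a : ℝ)) : ℂ)) (𝓝[>] 0)
      (𝓝 ((-2 * Real.log |t| : ℝ) : ℂ)) := by
    have := log_lim (|t| ^ (-2 : ℝ)) (by positivity)
    rw [Real.log_rpow ht'] at this
    exact (Complex.continuous_ofReal.tendsto _).comp this
  have hta : Tendsto (fun a : ℝ => ((|t| ^ a : ℝ) : ℂ)) (𝓝[>] 0) (𝓝 1) := by
    have c1 : Continuous (fun a : ℝ => ((|t| ^ a : ℝ) : ℂ)) :=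
      Complex.continuous_ofReal.comp (Real.continuous_const_rpow ht'.ne')
    have := (c1.tendsto 0).mono_left (nhdsWithin_le_nhds (s := Ioi 0))
    simpa using this
  have hid : Tendsto (fun a : ℝ => (a : ℂ)) (𝓝[>] 0) (𝓝 0) := by
    have := (Complex.continuous_ofReal.tendsto 0).mono_left (nhdsWithin_le_nhds (s := Ioi 0))
    simpa using this
  have hcS : Tendsto (fun a : ℝ => (rieszConst a : ℂ) *
        ∫ r : ℝ, ((|r - t⁻¹| ^ (-(1 - a)) : ℝ) : ℂ) * φ r) (𝓝[>] 0) (𝓝 (φ t⁻¹)) := by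
    have := (hid.mul L2).const_sub (φ t⁻¹)
    rw [zero_mul, sub_zero] at this
    refine this.congr' ?_
    filter_upwards [self_mem_nhdsWithin] with a ha
    have ha : (a : ℂ) ≠ 0 := by exact_mod_cast (show 0 < a from ha).ne'
    field_simp
    ring
  have R := ((L2.sub ((hcl'.mul hta).mul LD)).add (hlog.mul hcS)).const_mul ((|t|⁻¹ : ℝ) : ℂ)
  have hlim := tendsto_nhds_unique (L1.congr' ?_) R
  · simp only [if_neg ht, abs_inv, Real.log_inv] at hlim
    rw [sub_eq_iff_eq_add] at hlim
    rw [hlim]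
    push_cast
    ring
  · filter_upwards [Ioo_mem_nhdsGT (show (0:ℝ) < 1 by norm_num)] with a ha
    have ha0 : (a : ℂ) ≠ 0 := by exact_mod_cast ha.1.ne'
    rw [inv_change φ t ht a, if_neg ht]
    have i1 := int_aux φ hφ hc t⁻¹ a ha.1 ha.2
    have i2 : Integrable (fun r : ℝ => ((|r - t⁻¹| ^ (-(1 - a)) * |r| ^ (-a) : ℝ) : ℂ) * φ r) := by
      obtain ⟨δ, hδ, h0⟩ := away φ hsupp
      refine (i1.norm.const_mul (δ ^ (-a))).mono' ?_ (Eventually.of_forall fun r => ?_)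
      · have : Measurable (fun r : ℝ => ((|r - t⁻¹| ^ (-(1 - a)) * |r| ^ (-a) : ℝ) : ℂ)) := by
          fun_prop
        exact this.aestronglyMeasurable.mul hφ.continuous.aestronglyMeasurable
      · by_cases hφr : φ r = 0
        · simp [hφr]
        have hr1 : δ ≤ |r| := by
          by_contra hcon
          exact hφr (h0 r (by linarith))
        have hb : |r| ^ (-a) ≤ δ ^ (-a) :=
          Real.rpow_le_rpow_of_nonpos hδ hr1 (by linarith [ha.1])
        rw [norm_mul, norm_mul, Complex.norm_real, Complex.norm_real, norm_mul,
          Real.norm_of_nonneg (by positivity : 0 ≤ |r| ^ (-a))]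
        calc _ = |r| ^ (-a) * (‖|r - t⁻¹| ^ (-(1 - a))‖ * ‖φ r‖) := by ring
          _ ≤ _ := by gcongr
    have eD : ∫ r : ℝ, ((|r - t⁻¹| ^ (-(1 - a)) * (|r| ^ (-a) - |t⁻¹| ^ (-a)) : ℝ) : ℂ) * φ r =
        (∫ r : ℝ, ((|r - t⁻¹| ^ (-(1 - a)) * |r| ^ (-a) : ℝ) : ℂ) * φ r) -
        ((|t| ^ a : ℝ) : ℂ) * ∫ r : ℝ, ((|r - t⁻¹| ^ (-(1 - a)) : ℝ) : ℂ) * φ r := by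
      rw [← integral_const_mul, ← integral_sub i2 (i1.const_mul _)]
      congr 1; ext r
      rw [abs_inv, Real.inv_rpow ht'.le, ← Real.rpow_neg ht'.le, neg_neg]
      push_cast; ring
    rw [eD]
    have e1 : |t| ^ (-(1 - a)) = |t|⁻¹ * |t| ^ a := by
      rw [← Real.rpow_neg_one, ← Real.rpow_add ht']; congr 1; ring
    have e2 : (|t| ^ (-2 : ℝ)) ^ (-a) = |t| ^ a * |t| ^ a := by
      rw [← Real.rpow_mul ht'.le, ← Real.rpow_add ht']; congr 1; ring
    rw [e1, e2]
    push_cast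
    field_simp
    ring
end

section
/- Let χ : ℤ_pˣ → ℂˣ be a nontrivial continuous homomorphism, and let c ≥ 1 be its conductor exponent, i.e., the least positive integer such that χ(u) = 1 for all units u with |u − 1|_p ≤ p^{−c}. Let φ : ℚ_p → ℂ be locally constant with compact support, vanishing on a neighborhood of 0, and satisfying φ(u·t) = χ(u)^{−1}·φ(t) for all units u ∈ ℤ_pˣ and all t ∈ ℚ_p. Then for every t ≠ 0, H(φ)(t) = c·log(p)·φ(t). (Functions with the homogeneity of a ramified character of conductor exponent c are eigenfunctions of the conductor operator with eigenvalue c·log p.) -/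
open MeasureTheory Complex

variable {p : ℕ} [Fact p.Prime]

/-- The `p`-adic Fourier transform `𝓕f(ξ) = ∫ f(t)·e(tξ) dμ(t)`. -/
noncomputable def padicFourier [MeasurableSpace ℚ_[p]] (μ : Measure ℚ_[p])
    (e : AddChar ℚ_[p] Circle) (f : ℚ_[p] → ℂ) (ξ : ℚ_[p]) : ℂ :=
  ∫ t, f t * (e (t * ξ) : ℂ) ∂μ

/-- The inverse `p`-adic Fourier transform `𝓕⁻¹f(t) = ∫ f(ξ)·e(−tξ) dμ(ξ)`. -/
noncomputable def padicFourierInv [MeasurableSpace ℚ_[p]] (μ : Measure ℚ_[p])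
    (e : AddChar ℚ_[p] Circle) (f : ℚ_[p] → ℂ) (t : ℚ_[p]) : ℂ :=
  ∫ ξ, f ξ * (e (-(t * ξ)) : ℂ) ∂μ

/-- The conductor operator on `ℚ_p`:
`H(φ)(t) = log|t|_p·φ(t) + ∫ log|ξ|_p·(𝓕⁻¹φ)(ξ)·e(tξ) dμ(ξ)`. -/
noncomputable def padicCondOp [MeasurableSpace ℚ_[p]] (μ : Measure ℚ_[p])
    (e : AddChar ℚ_[p] Circle) (φ : ℚ_[p] → ℂ) (t : ℚ_[p]) : ℂ :=
  (Real.log ‖t‖ : ℂ) * φ t +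
    ∫ ξ, (Real.log ‖ξ‖ : ℂ) * padicFourierInv μ e φ ξ * (e (t * ξ) : ℂ) ∂μ

open scoped Pointwise

/-- A `p`-adic norm above `1` is at least `p`. -/
lemma aux_norm_ge (x : ℚ_[p]) (k : ℤ) (h : ¬ ‖x‖ ≤ (p : ℝ) ^ k) : (p : ℝ) ^ (k + 1) ≤ ‖x‖ := by
  by_contra h2
  exact h ((Padic.norm_le_pow_iff_norm_lt_pow_add_one x k).2 (not_le.1 h2))

lemma aux_e_one (e : AddChar ℚ_[p] Circle) (he1 : ∀ x : ℤ_[p], e (x : ℚ_[p]) = 1)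
    (x : ℚ_[p]) (hx : ‖x‖ ≤ 1) : e x = 1 := he1 ⟨x, hx⟩

lemma aux_measure_ball [MeasurableSpace ℚ_[p]] [BorelSpace ℚ_[p]]
    (μ : Measure ℚ_[p]) [μ.IsAddHaarMeasure] (hμ : μ {x : ℚ_[p] | ‖x‖ ≤ 1} = 1)
    (b : ℚ_[p]ˣ) : μ {x : ℚ_[p] | ‖x‖ ≤ ‖(b : ℚ_[p])‖} = distribHaarChar ℚ_[p] b := by
  have h := distribHaarChar_mul μ b {x : ℚ_[p] | ‖x‖ ≤ 1}
  rw [hμ, mul_one] at h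
  rw [h]
  congr 1
  ext x
  rw [Set.mem_smul_set_iff_inv_smul_mem]
  have hb : 0 < ‖(b : ℚ_[p])‖ := norm_pos_iff.2 b.ne_zero
  simp only [Set.mem_ofPred_eq, Units.smul_def, smul_eq_mul, norm_mul, Units.val_inv_eq_inv_val,
    norm_inv]
  rw [inv_mul_le_iff₀ hb, mul_one]

lemma aux_measure_mul [MeasurableSpace ℚ_[p]] [BorelSpace ℚ_[p]]
    (μ : Measure ℚ_[p]) [μ.IsAddHaarMeasure] (hμ : μ {x : ℚ_[p] | ‖x‖ ≤ 1} = 1)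
    (b : ℚ_[p]) (hb : b ≠ 0) :
    μ.real {x : ℚ_[p] | ‖x‖ ≤ ‖b‖} * μ.real {x : ℚ_[p] | ‖x‖ ≤ ‖b‖⁻¹} = 1 := by
  have h1 := aux_measure_ball μ hμ (Units.mk0 b hb)
  have h2 := aux_measure_ball μ hμ (Units.mk0 b hb)⁻¹
  simp only [Units.val_inv_eq_inv_val, norm_inv, Units.val_mk0] at h1 h2
  rw [Measure.real, Measure.real, h1, h2, ← ENNReal.toReal_mul, ← ENNReal.coe_mul, ← map_mul]
  simp

lemma aux_integral_unit [MeasurableSpace ℚ_[p]] [BorelSpace ℚ_[p]]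
    (μ : Measure ℚ_[p]) [μ.IsAddHaarMeasure] (hμ : μ {x : ℚ_[p] | ‖x‖ ≤ 1} = 1)
    (u : ℚ_[p]) (hu : ‖u‖ = 1) (f : ℚ_[p] → ℂ) : ∫ s, f (u * s) ∂μ = ∫ s, f s ∂μ := by
  have hu0 : u ≠ 0 := by
    rintro rfl
    simp at hu
  have h1 := aux_measure_ball μ hμ (Units.mk0 u hu0)
  simp only [Units.val_mk0, hu, hμ] at h1
  have hmp : MeasurePreserving (fun s => u * s) μ μ := by
    refine ⟨by fun_prop, ?_⟩
    ext s hs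
    rw [Measure.map_apply (by fun_prop) hs]
    have h := distribHaarChar_mul μ (Units.mk0 u hu0) ((fun s => u * s) ⁻¹' s)
    rw [← h1, one_mul] at h
    rw [h]
    congr 1
    ext x
    rw [Set.mem_smul_set_iff_inv_smul_mem]
    simp [Units.smul_def, hu0]
  exact hmp.integral_comp (Homeomorph.mulLeft₀ u hu0).measurableEmbedding f

/-- Orthogonality on a ball. -/
lemma aux_ball_char [MeasurableSpace ℚ_[p]] [BorelSpace ℚ_[p]]
    (μ : Measure ℚ_[p]) [μ.IsAddHaarMeasure]
    (e : AddChar ℚ_[p] Circle)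
    (he1 : ∀ x : ℤ_[p], e (x : ℚ_[p]) = 1)
    (he2 : ∃ x : ℚ_[p], ‖x‖ ≤ p ∧ e x ≠ 1) (b : ℚ_[p]) (x : ℚ_[p]) :
    ∫ ξ, Set.indicator {ξ : ℚ_[p] | ‖ξ‖ ≤ ‖b‖} (fun ξ => (e (ξ * x) : ℂ)) ξ ∂μ
      = if ‖x‖ * ‖b‖ ≤ 1 then (μ.real {ξ : ℚ_[p] | ‖ξ‖ ≤ ‖b‖} : ℂ) else 0 := by
  have hm : MeasurableSet {ξ : ℚ_[p] | ‖ξ‖ ≤ ‖b‖} :=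
    (isClosed_le continuous_norm continuous_const).measurableSet
  split_ifs with h
  · rw [integral_indicator hm, setIntegral_congr_fun (g := fun _ => (1 : ℂ)) hm]
    · simp
    · intro ξ hξ
      have : e (ξ * x) = 1 := by
        apply aux_e_one e he1
        rw [norm_mul, mul_comm]
        exact (mul_le_mul_of_nonneg_left hξ (norm_nonneg _)).trans h
      simp [this]
  · obtain ⟨y, hy, hey⟩ := he2
    have hx0 : x ≠ 0 := by
      rintro rfl
      simp at h
    have hxp : 0 < ‖x‖ := norm_pos_iff.2 hx0
    have hge : (p : ℝ) ≤ ‖x‖ * ‖b‖ := by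
      have := aux_norm_ge (x * b) 0 (by simpa using h)
      simpa using this
    have hh : ‖y / x‖ ≤ ‖b‖ := by
      rw [norm_div, div_le_iff₀ hxp, mul_comm]
      exact hy.trans hge
    set F : ℚ_[p] → ℂ := Set.indicator {ξ : ℚ_[p] | ‖ξ‖ ≤ ‖b‖} (fun ξ => (e (ξ * x) : ℂ)) with hF
    have key : ∫ ξ, F (ξ + y / x) ∂μ = (e y : ℂ) * ∫ ξ, F ξ ∂μ := by
      rw [← integral_const_mul]
      congr 1
      ext ξ
      have hiff : ‖ξ + y / x‖ ≤ ‖b‖ ↔ ‖ξ‖ ≤ ‖b‖ := by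
        constructor
        · intro h1
          have := (Padic.nonarchimedean (ξ + y / x) (-(y / x)))
          rw [norm_neg, add_neg_cancel_right] at this
          exact this.trans (max_le h1 hh)
        · intro h1
          exact (Padic.nonarchimedean _ _).trans (max_le h1 hh)
      by_cases h1 : ‖ξ‖ ≤ ‖b‖
      · rw [hF, Set.indicator_of_mem (by exact hiff.2 h1), Set.indicator_of_mem (by exact h1)]
        have : (ξ + y / x) * x = y + ξ * x := by field_simp; ring
        rw [this, AddChar.map_add_eq_mul, Circle.coe_mul]
      · rw [hF, Set.indicator_of_notMem (by exact fun h2 => h1 (hiff.1 h2)),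
          Set.indicator_of_notMem (by exact h1), mul_zero]
    rw [integral_add_right_eq_self] at key
    have hne : (e y : ℂ) ≠ 1 := by
      intro h1
      exact hey (Circle.ext (by simpa using h1))
    by_contra h0
    exact hne (mul_right_cancel₀ h0 (by rw [one_mul]; exact key.symm))

lemma aux_e_cont (e : AddChar ℚ_[p] Circle) (he : Continuous e) :
    Continuous fun x => (e x : ℂ) := continuous_induced_dom.comp he

lemma aux_integrable_mul [MeasurableSpace ℚ_[p]] [BorelSpace ℚ_[p]]
    (μ : Measure ℚ_[p]) [μ.IsAddHaarMeasure]
    (f : ℚ_[p] → ℂ) (hf : Continuous f) (hfs : HasCompactSupport f)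
    (g : ℚ_[p] → ℂ) (hg : Continuous g) : Integrable (fun x => f x * g x) μ :=
  (hf.mul hg).integrable_of_hasCompactSupport hfs.mul_right

lemma aux_fourierInv_cont [MeasurableSpace ℚ_[p]] [BorelSpace ℚ_[p]]
    (μ : Measure ℚ_[p]) [μ.IsAddHaarMeasure]
    (e : AddChar ℚ_[p] Circle) (he : Continuous e)
    (f : ℚ_[p] → ℂ) (hf : Continuous f) (hfs : HasCompactSupport f) :
    Continuous (padicFourierInv μ e f) := by
  have hec := aux_e_cont e he
  unfold padicFourierInv
  refine continuous_of_dominated (bound := fun s => ‖f s‖) (fun x => ?_) (fun x => ?_) ?_ ?_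
  · exact (aux_integrable_mul μ f hf hfs _ (by fun_prop)).aestronglyMeasurable
  · exact Filter.Eventually.of_forall fun s => by
      rw [norm_mul]
      exact mul_le_of_le_one_right (norm_nonneg _) (Circle.norm_coe _).le
  · exact (hf.integrable_of_hasCompactSupport hfs).norm
  · exact Filter.Eventually.of_forall fun s => by fun_prop

/-- Fourier inversion for test functions. -/
lemma aux_inversion [MeasurableSpace ℚ_[p]] [BorelSpace ℚ_[p]]
    (μ : Measure ℚ_[p]) [μ.IsAddHaarMeasure] (hμ : μ {x : ℚ_[p] | ‖x‖ ≤ 1} = 1)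
    (e : AddChar ℚ_[p] Circle) (he : Continuous e)
    (he1 : ∀ x : ℤ_[p], e (x : ℚ_[p]) = 1)
    (he2 : ∃ x : ℚ_[p], ‖x‖ ≤ p ∧ e x ≠ 1)
    (f : ℚ_[p] → ℂ) (hf : IsLocallyConstant f) (hfs : HasCompactSupport f)
    (R : ℝ) (hR : ∀ ξ, padicFourierInv μ e f ξ ≠ 0 → ‖ξ‖ ≤ R) (t : ℚ_[p]) :
    ∫ ξ, padicFourierInv μ e f ξ * (e (t * ξ) : ℂ) ∂μ = f t := by
  have hec := aux_e_cont e he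
  have hfc : Continuous f := hf.continuous
  obtain ⟨ε, hε, hball⟩ := Metric.isOpen_iff.1 (hf {f t}) t rfl
  obtain ⟨b, hb⟩ := NormedField.exists_lt_norm ℚ_[p] (max (max R 1) (2 / ε))
  have hbR : R < ‖b‖ := lt_of_le_of_lt ((le_max_left _ _).trans (le_max_left _ _)) hb
  have hb1 : 1 < ‖b‖ := lt_of_le_of_lt ((le_max_right _ _).trans (le_max_left _ _)) hb
  have hbε : 2 / ε < ‖b‖ := lt_of_le_of_lt (le_max_right _ _) hb
  have hbp : 0 < ‖b‖ := by linarith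
  have hb0 : b ≠ 0 := norm_pos_iff.1 hbp
  have hbε' : ‖b‖⁻¹ < ε := by
    rw [inv_lt_comm₀ hbp hε]
    refine lt_of_le_of_lt ?_ hbε
    rw [inv_eq_one_div]
    gcongr
    norm_num
  set B : Set ℚ_[p] := {ξ : ℚ_[p] | ‖ξ‖ ≤ ‖b‖} with hB
  have hBeq : B = Metric.closedBall 0 ‖b‖ := by
    ext; simp [hB]
  have hBclopen : IsClopen B := by
    rw [hBeq]
    exact IsUltrametricDist.isClopen_closedBall 0 hbp.ne'
  have hBc : IsCompact B := by
    rw [hBeq]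
    exact isCompact_closedBall 0 _
  set g : ℚ_[p] → ℂ := B.indicator 1 with hg
  have hgc : Continuous g := (continuous_const (y := (1 : ℂ))).indicator
    (by rw [hBclopen.frontier_eq]; simp)
  have h1 : ∀ ξ, padicFourierInv μ e f ξ * (e (t * ξ) : ℂ)
      = ∫ s, g ξ * (f s * (e (ξ * (t - s)) : ℂ)) ∂μ := by
    intro ξ
    rw [integral_const_mul]
    by_cases hξ : ξ ∈ B
    · rw [hg, Set.indicator_of_mem hξ, Pi.one_apply, one_mul, padicFourierInv, ← integral_mul_const]
      congr 1
      ext s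
      have : ξ * (t - s) = -(ξ * s) + t * ξ := by ring
      rw [this, AddChar.map_add_eq_mul, Circle.coe_mul, mul_assoc]
    · rw [hg, Set.indicator_of_notMem hξ, zero_mul]
      have : padicFourierInv μ e f ξ = 0 := by
        by_contra h
        exact hξ ((hR ξ h).trans hbR.le)
      rw [this, zero_mul]
  simp_rw [h1]
  rw [integral_integral_swap_of_hasCompactSupport
    (f := fun ξ s => g ξ * (f s * (e (ξ * (t - s)) : ℂ)))]
  rotate_left
  · simp only [Function.uncurry_def]
    fun_prop
  · refine HasCompactSupport.intro (hBc.prod hfs) ?_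
    rintro ⟨ξ, s⟩ hx
    simp only [Function.uncurry_apply_pair]
    by_cases hξ : ξ ∈ B
    · have : s ∉ tsupport f := fun h => hx ⟨hξ, h⟩
      rw [image_eq_zero_of_notMem_tsupport this]
      simp
    · rw [hg, Set.indicator_of_notMem hξ, zero_mul]
  have h2 : ∀ s, ∫ ξ, g ξ * (f s * (e (ξ * (t - s)) : ℂ)) ∂μ
      = Set.indicator (Metric.closedBall t ‖b‖⁻¹) (fun _ => f t * (μ.real B : ℂ)) s := by
    intro s
    have h3 := aux_ball_char μ e he1 he2 b (t - s)
    have h4 : ∀ ξ, g ξ * (f s * (e (ξ * (t - s)) : ℂ))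
        = f s * Set.indicator {ξ : ℚ_[p] | ‖ξ‖ ≤ ‖b‖} (fun ξ => (e (ξ * (t - s)) : ℂ)) ξ := by
      intro ξ
      by_cases hξ : ξ ∈ B
      · rw [hg, Set.indicator_of_mem hξ, Set.indicator_of_mem hξ, Pi.one_apply, one_mul]
      · rw [hg, Set.indicator_of_notMem hξ, Set.indicator_of_notMem hξ, zero_mul, mul_zero]
    simp_rw [h4]
    rw [integral_const_mul, h3]
    have hiff : ‖t - s‖ * ‖b‖ ≤ 1 ↔ s ∈ Metric.closedBall t ‖b‖⁻¹ := by
      rw [Metric.mem_closedBall, dist_comm, dist_eq_norm, ← le_div_iff₀ hbp, one_div]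
    by_cases hs : s ∈ Metric.closedBall t ‖b‖⁻¹
    · rw [if_pos (hiff.2 hs), Set.indicator_of_mem hs]
      have : f s = f t := hball (lt_of_le_of_lt (Metric.mem_closedBall.1 hs) hbε')
      rw [this]
    · rw [if_neg (fun h => hs (hiff.1 h)), Set.indicator_of_notMem hs, mul_zero]
  simp_rw [h2]
  rw [integral_indicator Metric.isClosed_closedBall.measurableSet, setIntegral_const]
  have h5 : μ.real (Metric.closedBall t ‖b‖⁻¹) = μ.real {x : ℚ_[p] | ‖x‖ ≤ ‖b‖⁻¹} := by
    rw [Measure.real, Measure.real, Measure.addHaar_closedBall_center]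
    congr 2
    ext; simp
  rw [h5, Complex.real_smul]
  have h6 := aux_measure_mul μ hμ b hb0
  have h7 : (μ.real B : ℂ) * (μ.real {x : ℚ_[p] | ‖x‖ ≤ ‖b‖⁻¹} : ℂ) = 1 := by
    rw [← Complex.ofReal_mul, h6, Complex.ofReal_one]
  linear_combination f t * h7

/-- A homogeneous function on one shell has inverse transform supported on one shell. -/
lemma aux_shell_support [MeasurableSpace ℚ_[p]] [BorelSpace ℚ_[p]]
    (μ : Measure ℚ_[p]) [μ.IsAddHaarMeasure] (hμ : μ {x : ℚ_[p] | ‖x‖ ≤ 1} = 1)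
    (e : AddChar ℚ_[p] Circle)
    (he1 : ∀ x : ℤ_[p], e (x : ℚ_[p]) = 1)
    (he2 : ∃ x : ℚ_[p], ‖x‖ ≤ p ∧ e x ≠ 1)
    (χ : ℤ_[p]ˣ →* ℂˣ)
    (c : ℕ) (hc1 : 1 ≤ c)
    (hctriv : ∀ u : ℤ_[p]ˣ, ‖(u : ℤ_[p]) - 1‖ ≤ (p : ℝ) ^ (-(c : ℤ)) → χ u = 1)
    (hex : ∃ u : ℤ_[p]ˣ, ‖(u : ℤ_[p]) - 1‖ ≤ (p : ℝ) ^ (1 - (c : ℤ)) ∧ χ u ≠ 1)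
    (φ : ℚ_[p] → ℂ)
    (hhom : ∀ (u : ℤ_[p]ˣ) (t : ℚ_[p]),
      φ (((u : ℤ_[p]) : ℚ_[p]) * t) = (((χ u)⁻¹ : ℂˣ) : ℂ) * φ t)
    (n : ℤ) (hn : ∀ s, φ s ≠ 0 → ‖s‖ = (p : ℝ) ^ n)
    (ξ : ℚ_[p]) (hξ : padicFourierInv μ e φ ξ ≠ 0) : ‖ξ‖ = (p : ℝ) ^ ((c : ℤ) - n) := by
  have hp1 : (1 : ℝ) < p := by exact_mod_cast (Fact.out : p.Prime).one_lt
  have hp0 : (0 : ℝ) < p := by linarith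
  apply le_antisymm
  · by_contra hlt
    apply hξ
    have hge := aux_norm_ge _ _ hlt
    have hξp : 0 < ‖ξ‖ := lt_of_lt_of_le (by positivity) hge
    have hξ0 : ξ ≠ 0 := norm_pos_iff.1 hξp
    obtain ⟨y, hy, hey⟩ := he2
    set h := y / ξ with hh
    have hhn : ‖h‖ ≤ (p : ℝ) ^ (n - c) := by
      rw [hh, norm_div, div_le_iff₀ hξp]
      calc ‖y‖ ≤ p := hy
        _ = (p : ℝ) ^ (n - c) * (p : ℝ) ^ ((c : ℤ) - n + 1) := by
          rw [← zpow_add₀ hp0.ne']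
          have : n - (c : ℤ) + ((c : ℤ) - n + 1) = 1 := by ring
          rw [this, zpow_one]
        _ ≤ _ := by gcongr
    have hinv' : ∀ (s k : ℚ_[p]), ‖k‖ ≤ (p : ℝ) ^ (n - c) → ‖s‖ = (p : ℝ) ^ n →
        φ (s + k) = φ s := by
      intro s k hk hs
      have hsp : 0 < ‖s‖ := by rw [hs]; positivity
      have hs0 : s ≠ 0 := norm_pos_iff.1 hsp
      have hks : ‖k / s‖ ≤ (p : ℝ) ^ (-(c : ℤ)) := by
        rw [norm_div, div_le_iff₀ hsp, hs, ← zpow_add₀ hp0.ne']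
        have : -(c : ℤ) + n = n - c := by ring
        rw [this]
        exact hk
      have hlt1 : ‖k / s‖ < 1 := by
        refine lt_of_le_of_lt hks ?_
        apply zpow_lt_one_of_neg₀ hp1
        omega
      have hu1 : ‖1 + k / s‖ = 1 := by
        rw [Padic.add_eq_max_of_ne]
        · rw [norm_one]; exact max_eq_left hlt1.le
        · rw [norm_one]; exact hlt1.ne'
      let u : ℤ_[p]ˣ := PadicInt.mkUnits hu1
      have hu : ((u : ℤ_[p]) : ℚ_[p]) = 1 + k / s := PadicInt.mkUnits_eq hu1
      have hχu : χ u = 1 := by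
        apply hctriv
        rw [PadicInt.norm_def]
        push_cast
        rw [hu]
        simpa using hks
      have := hhom u s
      rw [hχu, hu] at this
      have h2 : (1 + k / s) * s = s + k := by field_simp
      rw [h2] at this
      simpa using this
    have hinv : ∀ s, φ (s + h) = φ s := by
      intro s
      by_cases hs : ‖s‖ = (p : ℝ) ^ n
      · exact hinv' s h hhn hs
      · by_cases hs2 : ‖s + h‖ = (p : ℝ) ^ n
        · have := hinv' (s + h) (-h) (by rwa [norm_neg]) hs2
          rw [add_neg_cancel_right] at this
          exact this.symm
        · rw [not_imp_comm.1 (hn s) hs, not_imp_comm.1 (hn _) hs2]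
    have key : ∫ s, (fun s => φ s * (e (-(ξ * s)) : ℂ)) (s + h) ∂μ
        = (e (-y) : ℂ) * ∫ s, φ s * (e (-(ξ * s)) : ℂ) ∂μ := by
      rw [← integral_const_mul]
      congr 1
      ext s
      have : -(ξ * (s + h)) = -y + -(ξ * s) := by
        rw [hh]; field_simp; ring
      simp only [this, hinv, AddChar.map_add_eq_mul, Circle.coe_mul]
      ring
    have key := (integral_add_right_eq_self (μ := μ) (fun s => φ s * (e (-(ξ * s)) : ℂ)) h).symm.trans key
    have hne : (e (-y) : ℂ) ≠ 1 := by
      intro h1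
      apply hey
      have h2 : e (-y) = 1 := Circle.ext (by simpa using h1)
      rw [AddChar.map_neg_eq_inv] at h2
      exact inv_eq_one.1 h2
    by_contra h0
    exact hne (mul_right_cancel₀ h0 (by rw [one_mul]; exact key.symm))
  · by_contra hlt
    apply hξ
    have hle : ‖ξ‖ ≤ (p : ℝ) ^ ((c : ℤ) - n - 1) := by
      rw [Padic.norm_le_pow_iff_norm_lt_pow_add_one]
      simpa using hlt
    obtain ⟨u, hu, hχu⟩ := hex
    have hun : ‖((u : ℤ_[p]) : ℚ_[p])‖ = 1 := by
      rw [← PadicInt.norm_def]; exact PadicInt.norm_units u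
    have key := aux_integral_unit μ hμ _ hun (fun s => φ s * (e (-(ξ * s)) : ℂ))
    have h1 : ∀ s, φ (((u : ℤ_[p]) : ℚ_[p]) * s) * (e (-(ξ * (((u : ℤ_[p]) : ℚ_[p]) * s))) : ℂ)
        = (((χ u)⁻¹ : ℂˣ) : ℂ) * (φ s * (e (-(ξ * s)) : ℂ)) := by
      intro s
      rw [hhom]
      by_cases hs : φ s = 0
      · simp [hs]
      have hsn := hn s hs
      have h2 : -(ξ * (((u : ℤ_[p]) : ℚ_[p]) * s))
          = -(ξ * (((u : ℤ_[p]) : ℚ_[p]) - 1) * s) + -(ξ * s) := by ring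
      have h3 : e (-(ξ * (((u : ℤ_[p]) : ℚ_[p]) - 1) * s)) = 1 := by
        apply aux_e_one e he1
        rw [PadicInt.norm_def] at hu
        push_cast at hu
        rw [norm_neg, norm_mul, norm_mul, hsn]
        calc _ ≤ (p : ℝ) ^ ((c : ℤ) - n - 1) * (p : ℝ) ^ (1 - (c : ℤ)) * (p : ℝ) ^ n := by gcongr
          _ = 1 := by
            rw [← zpow_add₀ hp0.ne', ← zpow_add₀ hp0.ne']
            have : (c : ℤ) - n - 1 + (1 - c) + n = 0 := by ring
            rw [this, zpow_zero]
      rw [h2, AddChar.map_add_eq_mul, h3, one_mul, mul_assoc]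
    simp_rw [h1] at key
    rw [integral_const_mul] at key
    have hne : (((χ u)⁻¹ : ℂˣ) : ℂ) ≠ 1 := by
      intro h2
      exact hχu (inv_eq_one.1 (Units.ext h2))
    by_contra h0
    exact hne (mul_right_cancel₀ h0 (by rw [one_mul]; exact key))

/-- A function with the homogeneity of a ramified character `χ` of conductor exponent `c`
is an eigenfunction of the conductor operator with eigenvalue `c·log p`. -/
theorem ramified_homogeneous_eigenfunction [MeasurableSpace ℚ_[p]] [BorelSpace ℚ_[p]]
    (μ : Measure ℚ_[p]) [μ.IsAddHaarMeasure] (hμ : μ {x : ℚ_[p] | ‖x‖ ≤ 1} = 1)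
    (e : AddChar ℚ_[p] Circle) (he : Continuous e)
    (he1 : ∀ x : ℤ_[p], e (x : ℚ_[p]) = 1)
    (he2 : ∃ x : ℚ_[p], ‖x‖ ≤ p ∧ e x ≠ 1)
    (χ : ℤ_[p]ˣ →* ℂˣ) (hχcont : Continuous fun u : ℤ_[p]ˣ => ((χ u : ℂˣ) : ℂ))
    (hχnt : ∃ u : ℤ_[p]ˣ, χ u ≠ 1)
    (c : ℕ) (hc1 : 1 ≤ c)
    (hctriv : ∀ u : ℤ_[p]ˣ, ‖(u : ℤ_[p]) - 1‖ ≤ (p : ℝ) ^ (-(c : ℤ)) → χ u = 1)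
    (hcleast : ∀ c' : ℕ, 1 ≤ c' →
      (∀ u : ℤ_[p]ˣ, ‖(u : ℤ_[p]) - 1‖ ≤ (p : ℝ) ^ (-(c' : ℤ)) → χ u = 1) → c ≤ c')
    (φ : ℚ_[p] → ℂ) (hφlc : IsLocallyConstant φ) (hφcs : HasCompactSupport φ)
    (hφ0 : ∀ᶠ t in nhds (0 : ℚ_[p]), φ t = 0)
    (hhom : ∀ (u : ℤ_[p]ˣ) (t : ℚ_[p]),
      φ (((u : ℤ_[p]) : ℚ_[p]) * t) = (((χ u)⁻¹ : ℂˣ) : ℂ) * φ t)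
    (t : ℚ_[p]) (ht : t ≠ 0) :
    padicCondOp μ e φ t = (c : ℂ) * (Real.log p : ℂ) * φ t := by
  have hp1 : (1 : ℝ) < p := by exact_mod_cast (Fact.out : p.Prime).one_lt
  have hp0 : (0 : ℝ) < p := by linarith
  have hec := aux_e_cont e he
  have hex : ∃ u : ℤ_[p]ˣ, ‖(u : ℤ_[p]) - 1‖ ≤ (p : ℝ) ^ (1 - (c : ℤ)) ∧ χ u ≠ 1 := by
    rcases Nat.lt_or_ge 1 c with hc | hc
    · by_contra! hcon
      have := hcleast (c - 1) (by omega) (fun u hu => hcon u (by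
        convert hu using 2
        push_cast [Nat.cast_sub hc1]
        ring))
      omega
    · obtain ⟨u, hu⟩ := hχnt
      refine ⟨u, ?_, hu⟩
      have : c = 1 := by omega
      subst this
      simpa using PadicInt.norm_le_one ((u : ℤ_[p]) - 1)
  -- the shells
  set S : ℤ → Set ℚ_[p] := fun n => {s | ‖s‖ = (p : ℝ) ^ n} with hS
  set ψ : ℤ → ℚ_[p] → ℂ := fun n => (S n).indicator φ with hψ
  have hSclopen : ∀ n, IsClopen (S n) := by
    intro n
    have : S n = Metric.sphere 0 ((p : ℝ) ^ n) := by
      ext; simp [hS]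
    rw [this]
    exact IsUltrametricDist.isClopen_sphere 0 (by positivity)
  have hψlc : ∀ n, IsLocallyConstant (ψ n) := by
    intro n
    rw [IsLocallyConstant.iff_eventually_eq]
    intro x
    by_cases hx : x ∈ S n
    · filter_upwards [(hSclopen n).isOpen.mem_nhds hx, hφlc.eventually_eq x] with y hy hy2
      simp only [hψ]
      rw [Set.indicator_of_mem hy, Set.indicator_of_mem hx, hy2]
    · filter_upwards [(hSclopen n).compl.isOpen.mem_nhds hx] with y hy
      simp only [hψ]
      rw [Set.indicator_of_notMem hy, Set.indicator_of_notMem hx]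
  have hψcs : ∀ n, HasCompactSupport (ψ n) := by
    intro n
    refine hφcs.mono ?_
    intro x hx hx0
    apply hx
    simp only [hψ]
    rw [Set.indicator_apply_eq_zero]
    exact fun _ => hx0
  have hψn : ∀ n s, ψ n s ≠ 0 → ‖s‖ = (p : ℝ) ^ n := by
    intro n s hs
    have h : s ∈ S n := Set.mem_of_indicator_ne_zero hs
    exact h
  have hψhom : ∀ n, ∀ (u : ℤ_[p]ˣ) (t : ℚ_[p]),
      ψ n (((u : ℤ_[p]) : ℚ_[p]) * t) = (((χ u)⁻¹ : ℂˣ) : ℂ) * ψ n t := by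
    intro n u t
    have hun : ‖((u : ℤ_[p]) : ℚ_[p])‖ = 1 := by
      rw [← PadicInt.norm_def]; exact PadicInt.norm_units u
    have hiff : ((u : ℤ_[p]) : ℚ_[p]) * t ∈ S n ↔ t ∈ S n := by
      simp [hS, hun]
    simp only [hψ]
    by_cases h : t ∈ S n
    · rw [Set.indicator_of_mem h, Set.indicator_of_mem (hiff.2 h), hhom]
    · rw [Set.indicator_of_notMem h, Set.indicator_of_notMem (fun h2 => h (hiff.1 h2)), mul_zero]
  have hsupp := fun n => aux_shell_support μ hμ e he1 he2 χ c hc1 hctriv hex (ψ n) (hψhom n) n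
    (hψn n)
  have hlog : ∀ n ξ, (Real.log ‖ξ‖ : ℂ) * padicFourierInv μ e (ψ n) ξ * (e (t * ξ) : ℂ)
      = (((c : ℂ) - n) * (Real.log p : ℂ)) *
        (padicFourierInv μ e (ψ n) ξ * (e (t * ξ) : ℂ)) := by
    intro n ξ
    by_cases h : padicFourierInv μ e (ψ n) ξ = 0
    · simp [h]
    · rw [hsupp n ξ h, Real.log_zpow]
      push_cast
      ring
  have hint : ∀ n, Integrable (fun ξ => (Real.log ‖ξ‖ : ℂ) * padicFourierInv μ e (ψ n) ξ *
      (e (t * ξ) : ℂ)) μ := by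
    intro n
    simp_rw [hlog]
    apply Integrable.const_mul
    refine aux_integrable_mul μ _ (aux_fourierInv_cont μ e he _ (hψlc n).continuous (hψcs n)) ?_ _
      (by fun_prop)
    refine HasCompactSupport.intro (isCompact_closedBall 0 ((p : ℝ) ^ ((c : ℤ) - n))) ?_
    intro ξ hξ
    by_contra h
    exact hξ (by simpa using (hsupp n ξ h).le)
  have hval : ∀ n, ∫ ξ, (Real.log ‖ξ‖ : ℂ) * padicFourierInv μ e (ψ n) ξ * (e (t * ξ) : ℂ) ∂μ
      = (((c : ℂ) - n) * (Real.log p : ℂ)) * ψ n t := by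
    intro n
    simp_rw [hlog]
    rw [integral_const_mul, aux_inversion μ hμ e he he1 he2 (ψ n) (hψlc n) (hψcs n) _
      (fun ξ h => (hsupp n ξ h).le) t]
  -- finitely many shells suffice
  obtain ⟨M, hM⟩ : ∃ M : ℕ, ∀ s, φ s ≠ 0 → (p : ℝ) ^ (-(M : ℤ)) ≤ ‖s‖ ∧ ‖s‖ ≤ (p : ℝ) ^ (M : ℤ) := by
    obtain ⟨ε, hε, hball⟩ := Metric.eventually_nhds_iff.1 hφ0
    obtain ⟨R, hR⟩ := hφcs.isBounded.exists_norm_le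
    obtain ⟨M, hM⟩ := pow_unbounded_of_one_lt (max R ε⁻¹) hp1
    refine ⟨M, fun s hs => ⟨?_, ?_⟩⟩
    · have h1 : ε ≤ ‖s‖ := by
        by_contra h
        exact hs (hball (by simpa using h))
      refine le_trans ?_ h1
      rw [zpow_neg, zpow_natCast]
      exact inv_le_of_inv_le₀ hε ((le_max_right _ _).trans hM.le)
    · rw [zpow_natCast]
      exact (hR s (subset_tsupport _ hs)).trans ((le_max_left _ _).trans hM.le)
  set I := Finset.Icc (-(M : ℤ)) M with hI
  have hsum : ∀ s, φ s = ∑ n ∈ I, ψ n s := by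
    intro s
    by_cases hs : φ s = 0
    · rw [hs, Finset.sum_eq_zero]
      intro n _
      simp only [hψ]
      rw [Set.indicator_apply_eq_zero]
      exact fun _ => hs
    · have hb := hM s hs
      have hs0 : s ≠ 0 := by
        rintro rfl
        have : (0 : ℝ) < (p : ℝ) ^ (-(M : ℤ)) := by positivity
        rw [norm_zero] at hb
        linarith [hb.1]
      have hnorm := Padic.norm_eq_zpow_neg_valuation hs0
      rw [hnorm] at hb
      rw [zpow_le_zpow_iff_right₀ hp1, zpow_le_zpow_iff_right₀ hp1] at hb
      rw [Finset.sum_eq_single (-s.valuation)]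
      · simp only [hψ]
        rw [Set.indicator_of_mem (by exact hnorm)]
      · intro n _ hne
        by_contra h
        have := hψn n s h
        rw [hnorm] at this
        exact hne (zpow_right_injective₀ hp0 hp1.ne' this).symm
      · intro h
        exact absurd (Finset.mem_Icc.2 hb) h
  have hF : ∀ ξ, padicFourierInv μ e φ ξ = ∑ n ∈ I, padicFourierInv μ e (ψ n) ξ := by
    intro ξ
    unfold padicFourierInv
    rw [← integral_finsetSum]
    · congr 1
      ext s
      rw [hsum s, Finset.sum_mul]
    · intro n _
      exact aux_integrable_mul μ _ (hψlc n).continuous (hψcs n) _ (by fun_prop)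
  have hH : ∫ ξ, (Real.log ‖ξ‖ : ℂ) * padicFourierInv μ e φ ξ * (e (t * ξ) : ℂ) ∂μ
      = ∑ n ∈ I, (((c : ℂ) - n) * (Real.log p : ℂ)) * ψ n t := by
    simp_rw [hF, Finset.mul_sum, Finset.sum_mul]
    rw [integral_finsetSum _ (fun n _ => hint n)]
    exact Finset.sum_congr rfl fun n _ => hval n
  rw [padicCondOp, hH, hsum t, Finset.mul_sum, Finset.mul_sum, ← Finset.sum_add_distrib]
  refine Finset.sum_congr rfl fun n _ => ?_
  by_cases h : ψ n t = 0
  · simp [h]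
  · rw [hψn n t h, Real.log_zpow]
    push_cast
    ring
end

section
/- For every locally constant, compactly supported φ : ℚ_p → ℂ, the function ξ ↦ −log|ξ|_p·(𝓕φ)(ξ) is integrable and ∫_{ℚ_p} (−log|ξ|_p)·(𝓕φ)(ξ) dμ(ξ) = (log p/(1 − 1/p))·( ∫_{|t|_p ≤ 1} (φ(t) − φ(0))·|t|_p^{−1} dμ(t) + ∫_{|t|_p > 1} φ(t)·|t|_p^{−1} dμ(t) + (1/p)·φ(0) ). (Vladimirov's formula for the Fourier transform of −log|x|_p as a distribution.) -/
open MeasureTheory Complex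

variable {p : ℕ} [Fact p.Prime]

set_option linter.unusedVariables false
set_option linter.unusedSectionVars false

/-- The closed ball of radius `p ^ k`. -/
def pB (p : ℕ) [Fact p.Prime] (k : ℤ) : Set ℚ_[p] := {x | ‖x‖ ≤ (p : ℝ) ^ k}

lemma p_pos' : (0 : ℝ) < p := by exact_mod_cast (Fact.out : p.Prime).pos
lemma p_one' : (1 : ℝ) < p := by exact_mod_cast (Fact.out : p.Prime).one_lt

lemma pB_eq_closedBall (k : ℤ) : pB p k = Metric.closedBall 0 ((p : ℝ) ^ k) := by
  ext x; simp [pB]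

lemma mem_pB {k : ℤ} {x : ℚ_[p]} : x ∈ pB p k ↔ ‖x‖ ≤ (p : ℝ) ^ k := Iff.rfl

lemma pB_add {k : ℤ} {x y : ℚ_[p]} (hy : y ∈ pB p k) : x + y ∈ pB p k ↔ x ∈ pB p k := by
  have aux : ∀ {a b : ℚ_[p]}, a ∈ pB p k → b ∈ pB p k → a + b ∈ pB p k := by
    intro a b ha hb
    exact (Padic.nonarchimedean a b).trans (max_le ha hb)
  constructor
  · intro h
    have : -y ∈ pB p k := by simpa [pB] using hy
    simpa using aux h this
  · intro h; exact aux h hy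

lemma norm_zpow' {x : ℚ_[p]} (hx : x ≠ 0) : ∃ j : ℤ, ‖x‖ = (p : ℝ) ^ j :=
  ⟨_, Padic.norm_eq_zpow_neg_valuation hx⟩

lemma not_le_zpow {x : ℚ_[p]} {k : ℤ} (h : ¬ ‖x‖ ≤ (p : ℝ) ^ k) : (p : ℝ) ^ (k + 1) ≤ ‖x‖ := by
  have hx : x ≠ 0 := by
    rintro rfl
    exact h (by simpa using (zpow_pos p_pos' k).le)
  obtain ⟨j, hj⟩ := norm_zpow' hx
  rw [hj] at h ⊢
  rw [zpow_le_zpow_iff_right₀ p_one'] at h ⊢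
  omega

section
variable [MeasurableSpace ℚ_[p]] [BorelSpace ℚ_[p]]

lemma meas_pB (k : ℤ) : MeasurableSet (pB p k) := by
  rw [pB_eq_closedBall]; exact measurableSet_closedBall

lemma fin_pB (μ : Measure ℚ_[p]) [μ.IsAddHaarMeasure] (k : ℤ) : μ (pB p k) ≠ ⊤ := by
  rw [pB_eq_closedBall]; exact (isCompact_closedBall _ _).measure_lt_top.ne

lemma pB_succ (k : ℤ) : pB p (k + 1) =
    ⋃ i ∈ Finset.range p, (fun x => -((i : ℚ_[p]) * (p : ℚ_[p]) ^ (-(k + 1))) + x) ⁻¹' pB p k := by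
  have hp0 : (p : ℚ_[p]) ≠ 0 := by exact_mod_cast (Fact.out : p.Prime).ne_zero
  have hn : ‖(p : ℚ_[p]) ^ (-(k + 1))‖ = (p : ℝ) ^ (k + 1) := by simp
  have hppos := zpow_pos (p_pos' (p := p)) (k + 1)
  ext x
  simp only [Set.mem_iUnion, Set.mem_preimage, Finset.mem_range, exists_prop]
  constructor
  · intro hx
    set y : ℚ_[p] := x * (p : ℚ_[p]) ^ (k + 1) with hy
    have hxy : x = y * (p : ℚ_[p]) ^ (-(k + 1)) := by
      rw [hy, mul_assoc, ← zpow_add₀ hp0]; simp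
    have hy1 : ‖y‖ ≤ 1 := by
      rw [hxy, mem_pB, norm_mul, hn] at hx
      exact le_of_mul_le_mul_right (by simpa using hx) hppos
    obtain ⟨i, hi, hi2⟩ := PadicInt.exists_mem_range (⟨y, hy1⟩ : ℤ_[p])
    refine ⟨i, hi, ?_⟩
    have h3 : ‖y - (i : ℚ_[p])‖ ≤ (p : ℝ) ^ (-1 : ℤ) := by
      rw [PadicInt.maximalIdeal_eq_span_p, Ideal.mem_span_singleton,
        ← PadicInt.norm_lt_one_iff_dvd] at hi2
      have := (Padic.norm_le_pow_iff_norm_lt_pow_add_one (y - (i : ℚ_[p])) (-1)).2 (by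
        rw [neg_add_cancel, zpow_zero]; exact hi2)
      exact this
    rw [mem_pB, hxy, show -((i : ℚ_[p]) * (p : ℚ_[p]) ^ (-(k + 1))) + y * (p : ℚ_[p]) ^ (-(k + 1))
      = (y - i) * (p : ℚ_[p]) ^ (-(k + 1)) by ring, norm_mul, hn]
    calc _ ≤ (p : ℝ) ^ (-1 : ℤ) * (p : ℝ) ^ (k + 1) := by gcongr
      _ = _ := by rw [← zpow_add₀ p_pos'.ne']; congr 1; ring
  · rintro ⟨i, hi, h⟩
    have h1 : (i : ℚ_[p]) * (p : ℚ_[p]) ^ (-(k + 1)) ∈ pB p (k + 1) := by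
      rw [mem_pB, norm_mul, hn]
      have := Padic.norm_int_le_one (p := p) i
      exact mul_le_of_le_one_left hppos.le (by simpa using this)
    have h2 : -((i : ℚ_[p]) * (p : ℚ_[p]) ^ (-(k + 1))) + x ∈ pB p (k + 1) :=
      le_trans (mem_pB.1 h) (zpow_le_zpow_right₀ p_one'.le (by omega))
    simpa using (pB_add h1).2 h2

lemma pB_disj (k : ℤ) : (↑(Finset.range p) : Set ℕ).PairwiseDisjoint
    (fun i : ℕ => (fun x => -((i : ℚ_[p]) * (p : ℚ_[p]) ^ (-(k + 1))) + x) ⁻¹' pB p k) := by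
  have hn : ‖(p : ℚ_[p]) ^ (-(k + 1))‖ = (p : ℝ) ^ (k + 1) := by simp
  have hppos := zpow_pos (p_pos' (p := p)) (k + 1)
  intro i hi j hj hij
  simp only [Finset.coe_range, Set.mem_Iio] at hi hj
  refine Set.disjoint_left.2 fun x hx hx' => hij ?_
  simp only [Set.mem_preimage] at hx hx'
  have h1 : ((j : ℤ) - (i : ℤ) : ℤ) * (p : ℚ_[p]) ^ (-(k + 1)) ∈ pB p k := by
    rw [← pB_add hx']
    convert hx using 1
    push_cast; ring
  rw [mem_pB, norm_mul, hn] at h1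
  have h2 : ‖(((j : ℤ) - (i : ℤ) : ℤ) : ℚ_[p])‖ < 1 := by
    by_contra! hc
    have : (p : ℝ) ^ (k + 1) ≤ (p : ℝ) ^ k := le_trans (le_mul_of_one_le_left hppos.le hc) h1
    rw [zpow_le_zpow_iff_right₀ p_one'] at this
    omega
  rw [Padic.norm_intCast_lt_one_iff] at h2
  have := Int.eq_zero_of_abs_lt_dvd h2 (by rw [abs_lt]; constructor <;> omega)
  omega

lemma measure_pB_succ (μ : Measure ℚ_[p]) [μ.IsAddHaarMeasure] (k : ℤ) :
    μ.real (pB p (k + 1)) = p * μ.real (pB p k) := by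
  rw [measureReal_def, pB_succ, measure_biUnion_finset (pB_disj k)
    (fun i _ => (measurable_const_add _) (meas_pB k))]
  simp [measure_preimage_add, measureReal_def]

lemma measure_pB (μ : Measure ℚ_[p]) [μ.IsAddHaarMeasure]
    (hμ : μ {x : ℚ_[p] | ‖x‖ ≤ 1} = 1) (k : ℤ) : μ.real (pB p k) = (p : ℝ) ^ k := by
  have hp := (p_pos' (p := p)).ne'
  induction k using Int.induction_on with
  | zero => simp [measureReal_def, pB, hμ]
  | succ i ih => rw [measure_pB_succ, ih, zpow_add_one₀ hp, mul_comm]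
  | pred i ih =>
    have := measure_pB_succ μ (-(i : ℤ) - 1)
    rw [sub_add_cancel, ih] at this
    rw [zpow_sub_one₀ hp, this]; field_simp

/-- the trick: invariance under translation forces vanishing. -/
lemma integral_zero_of_shift (μ : Measure ℚ_[p]) [μ.IsAddHaarMeasure] (f : ℚ_[p] → ℂ)
    (s : ℚ_[p]) (c : ℂ) (hc : c ≠ 1) (h : ∀ x, f (x + s) = c * f x) : ∫ x, f x ∂μ = 0 := by
  have h1 := integral_add_right_eq_self (μ := μ) f s
  simp only [h, integral_const_mul] at h1
  by_contra h0
  exact hc (mul_right_cancel₀ h0 (by simpa using h1))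

lemma char_triv {e : AddChar ℚ_[p] Circle} (he1 : ∀ x : ℤ_[p], e (x : ℚ_[p]) = 1) {x : ℚ_[p]}
    (hx : ‖x‖ ≤ 1) : e x = 1 := he1 ⟨x, hx⟩

lemma exists_shift {e : AddChar ℚ_[p] Circle} (he2 : ∃ x : ℚ_[p], ‖x‖ ≤ p ∧ e x ≠ 1)
    {t : ℚ_[p]} {k : ℤ} (ht : ¬ ‖t‖ ≤ (p : ℝ) ^ k) :
    ∃ s ∈ pB p (-k), ((e (s * t) : Circle) : ℂ) ≠ 1 := by
  obtain ⟨x, hx, hx1⟩ := he2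
  have h1 := not_le_zpow ht
  have hpp := zpow_pos (p_pos' (p := p)) (k + 1)
  have ht0 : t ≠ 0 := norm_pos_iff.1 (hpp.trans_le h1)
  refine ⟨x / t, ?_, ?_⟩
  · rw [mem_pB, norm_div]
    calc ‖x‖ / ‖t‖ ≤ p / (p : ℝ) ^ (k + 1) := by gcongr
      _ = _ := by
        rw [zpow_add_one₀ p_pos'.ne', zpow_neg]
        have := (p_pos' (p := p)).ne'
        field_simp
  · rw [div_mul_cancel₀ _ ht0]
    exact fun h => hx1 (Circle.ext (by simpa using h))

lemma int_char (μ : Measure ℚ_[p]) [μ.IsAddHaarMeasure]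
    (hμ : μ {x : ℚ_[p] | ‖x‖ ≤ 1} = 1)
    {e : AddChar ℚ_[p] Circle} (he1 : ∀ x : ℤ_[p], e (x : ℚ_[p]) = 1)
    (he2 : ∃ x : ℚ_[p], ‖x‖ ≤ p ∧ e x ≠ 1) (k : ℤ) (t : ℚ_[p]) :
    ∫ ξ in pB p k, (e (t * ξ) : ℂ) ∂μ = if ‖t‖ ≤ (p : ℝ) ^ (-k) then (p : ℂ) ^ k else 0 := by
  split_ifs with h
  · have : ∀ ξ ∈ pB p k, (e (t * ξ) : ℂ) = 1 := by
      intro ξ hξ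
      rw [char_triv he1]; · simp
      rw [norm_mul]
      calc _ ≤ (p : ℝ) ^ (-k) * (p : ℝ) ^ k := by gcongr; exact hξ
        _ = 1 := by rw [← zpow_add₀ p_pos'.ne']; simp
    rw [setIntegral_congr_fun (meas_pB k) this]
    simp [measure_pB μ hμ]
  · obtain ⟨s, hs, hs1⟩ := exists_shift he2 h
    rw [neg_neg] at hs
    rw [← integral_indicator (meas_pB k)]
    apply integral_zero_of_shift μ _ s _ hs1
    intro x
    by_cases hx : x ∈ pB p k
    · rw [Set.indicator_of_mem hx, Set.indicator_of_mem ((pB_add hs).2 hx), mul_add,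
        AddChar.map_add_eq_mul, mul_comm s t]
      push_cast; ring
    · rw [Set.indicator_of_notMem hx, Set.indicator_of_notMem (fun h => hx ((pB_add hs).1 h))]
      simp

lemma fourier_supp (μ : Measure ℚ_[p]) [μ.IsAddHaarMeasure]
    {e : AddChar ℚ_[p] Circle}
    (he2 : ∃ x : ℚ_[p], ‖x‖ ≤ p ∧ e x ≠ 1) (φ : ℚ_[p] → ℂ) (n : ℤ)
    (hφ : ∀ x, ∀ s ∈ pB p (-n), φ (x + s) = φ x) (ξ : ℚ_[p]) (hξ : ξ ∉ pB p n) :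
    padicFourier μ e φ ξ = 0 := by
  obtain ⟨s, hs, hs1⟩ := exists_shift he2 hξ
  apply integral_zero_of_shift μ _ s _ hs1
  intro x
  rw [hφ _ _ hs, add_mul, AddChar.map_add_eq_mul]
  push_cast; ring

lemma log_sum {ξ : ℚ_[p]} (h0 : ξ ≠ 0) (n : ℤ) (hξ : ξ ∈ pB p n) :
    HasSum (fun m : ℕ => (pB p (n - 1 - m)).indicator (fun _ => (1 : ℝ)) ξ)
      (n - Real.log ‖ξ‖ / Real.log p) := by
  obtain ⟨j, hj⟩ := norm_zpow' h0
  have hl : Real.log p ≠ 0 := (Real.log_pos p_one').ne'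
  rw [mem_pB, hj, zpow_le_zpow_iff_right₀ p_one'] at hξ
  have key : ∀ m : ℕ, (ξ ∈ pB p (n - 1 - m)) ↔ m ∈ Finset.range (n - j).toNat := by
    intro m
    rw [mem_pB, hj, zpow_le_zpow_iff_right₀ p_one', Finset.mem_range]; omega
  have := hasSum_sum_of_ne_finset_zero (L := .unconditional ℕ) (s := Finset.range (n - j).toNat)
    (f := fun m : ℕ => (pB p (n - 1 - m)).indicator (fun _ => (1 : ℝ)) ξ)
    (fun m hm => Set.indicator_of_notMem (fun h => hm ((key m).1 h)) _)
  convert this using 1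
  rw [Finset.sum_congr rfl (fun m hm => Set.indicator_of_mem ((key m).2 hm) _), hj, Real.log_zpow,
    mul_div_cancel_right₀ _ hl]
  simp only [Finset.sum_const, Finset.card_range, nsmul_eq_mul, mul_one]
  have : ((n - j).toNat : ℤ) = n - j := Int.toNat_of_nonneg (by omega)
  exact_mod_cast this.symm

lemma ae_ne_zero (μ : Measure ℚ_[p]) [μ.IsAddHaarMeasure]
    (hμ : μ {x : ℚ_[p] | ‖x‖ ≤ 1} = 1) : ∀ᵐ ξ ∂μ, ξ ≠ 0 := by
  rw [ae_iff]
  simp only [not_not, ne_eq, Set.ofPred_eq_eq_singleton]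
  exact measure_singleton 0
end

section
variable [MeasurableSpace ℚ_[p]] [BorelSpace ℚ_[p]]

lemma hasSum_geo (a : ℤ) :
    HasSum (fun m : ℕ => (p : ℝ) ^ (a - m)) ((p : ℝ) ^ a / (1 - 1 / (p : ℝ))) := by
  have hp := (p_pos' (p := p)).ne'
  have h := (hasSum_geometric_of_lt_one (r := 1 / (p : ℝ)) (by positivity)
    (by rw [div_lt_one p_pos']; exact p_one')).mul_left ((p : ℝ) ^ a)
  have h2 : (fun m : ℕ => (p : ℝ) ^ (a - m)) = fun m : ℕ => (p : ℝ) ^ a * (1 / (p : ℝ)) ^ m := by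
    ext m
    rw [zpow_sub₀ hp, zpow_natCast, one_div, inv_pow, div_eq_mul_inv]
  rw [h2, div_eq_mul_inv]
  exact h

/-- `∑ₘ 1_{B (n-1-m)}` -/
noncomputable def pG (p : ℕ) [Fact p.Prime] (n : ℤ) (ξ : ℚ_[p]) : ℝ :=
  ∑' m : ℕ, (pB p (n - 1 - m)).indicator (fun _ => (1 : ℝ)) ξ

lemma int_ind (μ : Measure ℚ_[p]) [μ.IsAddHaarMeasure]
    (hμ : μ {x : ℚ_[p] | ‖x‖ ≤ 1} = 1) (k : ℤ) :
    ∫ ξ, (pB p k).indicator (fun _ => (1 : ℝ)) ξ ∂μ = (p : ℝ) ^ k := by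
  rw [integral_indicator (meas_pB k)]
  simp [measure_pB μ hμ]

lemma integrable_ind (μ : Measure ℚ_[p]) [μ.IsAddHaarMeasure] (k : ℤ) :
    Integrable ((pB p k).indicator (fun _ => (1 : ℝ))) μ :=
  (integrable_indicator_iff (meas_pB k)).2 (integrableOn_const (fin_pB μ k))

lemma integrable_pG (μ : Measure ℚ_[p]) [μ.IsAddHaarMeasure]
    (hμ : μ {x : ℚ_[p] | ‖x‖ ≤ 1} = 1) (n : ℤ) : Integrable (pG p n) μ := by
  have h := hasSum_integral_of_summable_integral_norm (μ := μ)
    (F := fun m : ℕ => (pB p (n - 1 - m)).indicator (fun _ => (1 : ℝ)))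
    (fun m => integrable_ind μ _) (by
      simp only [norm_indicator_eq_indicator_norm, norm_one, int_ind μ hμ]
      exact (hasSum_geo _).summable)
  simp only [int_ind μ hμ] at h
  have h2 := h.unique (hasSum_geo (p := p) (n - 1))
  apply Integrable.of_integral_ne_zero
  unfold pG
  rw [h2]
  have : 1 / (p : ℝ) < 1 := by rw [div_lt_one p_pos']; exact p_one'
  have h4 := zpow_pos (p_pos' (p := p)) (n - 1)
  exact (div_pos h4 (by linarith)).ne'

lemma pG_of_notMem {n : ℤ} {ξ : ℚ_[p]} (h : ξ ∉ pB p n) : pG p n ξ = 0 := by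
  unfold pG
  convert tsum_zero with m
  apply Set.indicator_of_notMem
  intro h'
  exact h (le_trans (mem_pB.1 h') (zpow_le_zpow_right₀ p_one'.le (by omega)))

lemma log_eq {n : ℤ} {ξ : ℚ_[p]} (h0 : ξ ≠ 0) (h : ξ ∈ pB p n) :
    -Real.log ‖ξ‖ = Real.log p * (pG p n ξ - n) := by
  have := (log_sum h0 n h).tsum_eq
  unfold pG
  rw [this]
  have hl : Real.log p ≠ 0 := (Real.log_pos p_one').ne'
  field_simp; ring

lemma integrableOn_log (μ : Measure ℚ_[p]) [μ.IsAddHaarMeasure]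
    (hμ : μ {x : ℚ_[p] | ‖x‖ ≤ 1} = 1) (n : ℤ) :
    IntegrableOn (fun ξ : ℚ_[p] => -Real.log ‖ξ‖) (pB p n) μ := by
  have h1 : IntegrableOn (fun ξ : ℚ_[p] => Real.log p * (pG p n ξ - n)) (pB p n) μ :=
    ((integrable_pG μ hμ n).integrableOn.sub (integrableOn_const (fin_pB μ n))).const_mul _
  refine h1.congr ?_
  filter_upwards [ae_restrict_of_ae (ae_ne_zero μ hμ), ae_restrict_mem (meas_pB n)] with ξ h0 h
  exact (log_eq h0 h).symm

lemma int_pG_char (μ : Measure ℚ_[p]) [μ.IsAddHaarMeasure]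
    (hμ : μ {x : ℚ_[p] | ‖x‖ ≤ 1} = 1)
    {e : AddChar ℚ_[p] Circle} (he : Continuous e) (he1 : ∀ x : ℤ_[p], e (x : ℚ_[p]) = 1)
    (he2 : ∃ x : ℚ_[p], ‖x‖ ≤ p ∧ e x ≠ 1) (n : ℤ) (t : ℚ_[p]) :
    HasSum (fun m : ℕ => if ‖t‖ ≤ (p : ℝ) ^ (-(n - 1 - m)) then (p : ℂ) ^ (n - 1 - m) else 0)
    (∫ ξ in pB p n, (pG p n ξ : ℂ) * (e (t * ξ) : ℂ) ∂μ) := by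
  have hc : Continuous (fun ξ : ℚ_[p] => (e (t * ξ) : ℂ)) := by fun_prop
  have h := hasSum_integral_of_summable_integral_norm (μ := μ)
    (F := fun m : ℕ => (pB p (n - 1 - m)).indicator (fun ξ => (e (t * ξ) : ℂ)))
    (fun m => by
      rw [integrable_indicator_iff (meas_pB _), pB_eq_closedBall]
      exact hc.continuousOn.integrableOn_compact (isCompact_closedBall _ _)) (by
      simp only [norm_indicator_eq_indicator_norm, Circle.norm_coe, int_ind μ hμ]
      exact (hasSum_geo _).summable)
  simp only [integral_indicator (meas_pB _), int_char μ hμ he1 he2] at h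
  rw [setIntegral_eq_integral_of_forall_compl_eq_zero]
  · refine (congrArg (HasSum _) (integral_congr_ae (Filter.Eventually.of_forall fun ξ => ?_))).mpr h
    rw [pG, Complex.ofReal_tsum, ← tsum_mul_right]
    congr 1
    ext m
    by_cases hm : ξ ∈ pB p (n - 1 - m) <;> simp [hm]
  · intro ξ hξ
    simp [pG_of_notMem hξ]

lemma kernel_eq (μ : Measure ℚ_[p]) [μ.IsAddHaarMeasure]
    (hμ : μ {x : ℚ_[p] | ‖x‖ ≤ 1} = 1)
    {e : AddChar ℚ_[p] Circle} (he : Continuous e) (he1 : ∀ x : ℤ_[p], e (x : ℚ_[p]) = 1)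
    (he2 : ∃ x : ℚ_[p], ‖x‖ ≤ p ∧ e x ≠ 1) (n : ℤ) (t : ℚ_[p]) :
    ∫ ξ in pB p n, -(Real.log ‖ξ‖ : ℂ) * (e (t * ξ) : ℂ) ∂μ = 
      if ‖t‖ ≤ (p : ℝ) ^ (-n) then 
        ((Real.log p * ((p : ℝ) ^ (n - 1) / (1 - 1 / (p : ℝ)) - n * (p : ℝ) ^ n) : ℝ) : ℂ)
      else ((Real.log p / (1 - 1 / (p : ℝ)) * ‖t‖⁻¹ : ℝ) : ℂ) := by
  have hc : Continuous (fun ξ : ℚ_[p] => (e (t * ξ) : ℂ)) := by fun_prop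
  have hI : IntegrableOn (fun ξ : ℚ_[p] => (e (t * ξ) : ℂ)) (pB p n) μ := by
    rw [pB_eq_closedBall]
    exact hc.continuousOn.integrableOn_compact (isCompact_closedBall _ _)
  have hG : IntegrableOn (fun ξ : ℚ_[p] => (pG p n ξ : ℂ) * (e (t * ξ) : ℂ)) (pB p n) μ := by
    refine ((integrable_pG μ hμ n).ofReal.mul_bdd (c := 1) hc.aestronglyMeasurable ?_).integrableOn
    exact Filter.Eventually.of_forall fun ξ => (Circle.norm_coe _).le
  have e1 : ∫ ξ in pB p n, -(Real.log ‖ξ‖ : ℂ) * (e (t * ξ) : ℂ) ∂μ =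
      (Real.log p : ℂ) * ((∫ ξ in pB p n, (pG p n ξ : ℂ) * (e (t * ξ) : ℂ) ∂μ) -
        n * ∫ ξ in pB p n, (e (t * ξ) : ℂ) ∂μ) := by
    rw [← integral_const_mul, ← integral_sub hG (hI.const_mul _), ← integral_const_mul]
    apply integral_congr_ae
    filter_upwards [ae_restrict_of_ae (ae_ne_zero μ hμ), ae_restrict_mem (meas_pB n)] with ξ h0 h
    have := log_eq h0 h
    rw [← Complex.ofReal_neg, this]
    push_cast; ring
  rw [e1, int_char μ hμ he1 he2]
  have hS := int_pG_char μ hμ he he1 he2 n t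
  have hgeo : ∀ a : ℤ, HasSum (fun m : ℕ => (p : ℂ) ^ (a - m))
      (((p : ℝ) ^ a / (1 - 1 / (p : ℝ)) : ℝ) : ℂ) := by
    intro a
    have := Complex.hasSum_ofReal.2 (hasSum_geo (p := p) a)
    simpa using this
  split_ifs with h
  · have : ∀ m : ℕ, ‖t‖ ≤ (p : ℝ) ^ (-(n - 1 - m)) := fun m =>
      h.trans (zpow_le_zpow_right₀ p_one'.le (by omega))
    simp only [this, if_true] at hS
    rw [hS.unique (hgeo _)]
    push_cast; ring
  · have ht : t ≠ 0 := by
      rintro rfl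
      exact h (by simpa using (zpow_pos p_pos' (-n)).le)
    obtain ⟨j, hj⟩ := norm_zpow' ht
    rw [hj, zpow_le_zpow_iff_right₀ p_one'] at h
    obtain ⟨N, hN⟩ := Int.eq_ofNat_of_zero_le (a := j + n - 1) (by omega)
    have h2 := (hasSum_nat_add_iff' N).2 hS
    rw [Finset.sum_eq_zero, sub_zero] at h2
    · have : ∀ m : ℕ, ‖t‖ ≤ (p : ℝ) ^ (-(n - 1 - ((m + N : ℕ) : ℤ))) := fun m => by
        rw [hj]; exact (zpow_le_zpow_right₀ p_one'.le (by push_cast; omega))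
      simp only [this, if_true] at h2
      have h3 := hgeo (-j)
      have : ∀ m : ℕ, n - 1 - ((m + N : ℕ) : ℤ) = - j - m := by intro m; push_cast; omega
      simp only [this] at h2
      rw [h2.unique h3, hj]
      push_cast
      rw [zpow_neg]; ring
    · intro m hm
      rw [Finset.mem_range] at hm
      rw [if_neg]
      rw [hj, zpow_le_zpow_iff_right₀ p_one']
      omega

lemma exists_level (φ : ℚ_[p] → ℂ) (hφlc : IsLocallyConstant φ) (hφcs : HasCompactSupport φ) :
    ∃ n : ℕ, ∀ x, ∀ s ∈ pB p (-n), φ (x + s) = φ x := by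
  obtain ⟨δ, hδ, H⟩ := lebesgue_number_lemma_of_metric (s := tsupport φ) (c := fun c : ℂ => φ ⁻¹' {c})
    hφcs (fun c => hφlc {c}) (fun x _ => Set.mem_iUnion.2 ⟨φ x, rfl⟩)
  obtain ⟨n, hn⟩ := exists_pow_lt_of_lt_one hδ (y := (p : ℝ)⁻¹) (inv_lt_one_of_one_lt₀ p_one')
  have key : ∀ x y, x ∈ tsupport φ → dist y x < δ → φ y = φ x := by
    intro x y hx hy
    obtain ⟨c, hc⟩ := H x hx
    have h1 : φ y = c := hc hy
    have h2 : φ x = c := hc (Metric.mem_ball_self hδ)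
    rw [h1, h2]
  refine ⟨n, fun x s hs => ?_⟩
  have hs' : ‖s‖ < δ := by
    refine lt_of_le_of_lt hs ?_
    simpa using hn
  by_cases h1 : x ∈ tsupport φ
  · exact key x _ h1 (by simpa [dist_eq_norm] using hs')
  by_cases h2 : x + s ∈ tsupport φ
  · exact (key (x + s) x h2 (by simpa [dist_eq_norm] using hs')).symm
  rw [image_eq_zero_of_notMem_tsupport h1, image_eq_zero_of_notMem_tsupport h2]

lemma int_inv_norm (μ : Measure ℚ_[p]) [μ.IsAddHaarMeasure]
    (hμ : μ {x : ℚ_[p] | ‖x‖ ≤ 1} = 1) (n : ℕ) :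
    ∫ t in pB p 0 \ pB p (-n), ((‖t‖⁻¹ : ℝ) : ℂ) ∂μ = n * (1 - 1 / (p : ℂ)) := by
  have hp := (p_pos' (p := p)).ne'
  have hI : ∀ k : ℤ, IntegrableOn (fun t : ℚ_[p] => ((‖t‖⁻¹ : ℝ) : ℂ)) (pB p 0 \ pB p k) μ := by
    intro k
    refine Measure.integrableOn_of_bounded (M := ((p : ℝ) ^ (k + 1))⁻¹)
      (measure_ne_top_of_subset Set.sdiff_subset (fin_pB μ 0)) ?_ ?_
    · exact (Complex.measurable_ofReal.comp measurable_norm.inv).aestronglyMeasurable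
    · filter_upwards [ae_restrict_mem ((meas_pB 0).diff (meas_pB k))] with t ht
      have := not_le_zpow ht.2
      have h4 := zpow_pos (p_pos' (p := p)) (k + 1)
      simp only [Complex.norm_real, norm_inv, norm_norm]
      gcongr
  have sub : ∀ {a b : ℤ}, a ≤ b → pB p a ⊆ pB p b := fun h x hx =>
    le_trans (mem_pB.1 hx) (zpow_le_zpow_right₀ p_one'.le h)
  induction n with
  | zero => simp
  | succ n ih =>
    have hs : pB p 0 \ pB p (-(n + 1 : ℕ)) = 
        (pB p 0 \ pB p (-n)) ∪ (pB p (-n) \ pB p (-(n + 1 : ℕ))) := by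
      rw [Set.sdiff_union_sdiff_cancel (sub (by simp)) (sub (by simp))]
    have hd : Disjoint (pB p 0 \ pB p (-n)) (pB p (-n) \ pB p (-(n + 1 : ℕ))) :=
      Set.disjoint_left.2 fun x hx hx' => hx.2 hx'.1
    rw [hs, setIntegral_union hd ((meas_pB _).diff (meas_pB _)) (hI _) ((hI _).mono_set
      (Set.sdiff_subset_sdiff_left (sub (by simp)))), ih]
    have : ∀ t ∈ pB p (-n) \ pB p (-(n + 1 : ℕ)), ((‖t‖⁻¹ : ℝ) : ℂ) = (p : ℂ) ^ n := by
      intro t ht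
      have h1 := mem_pB.1 ht.1
      have h2 := not_le_zpow ht.2
      have : ‖t‖ = (p : ℝ) ^ (-n : ℤ) := le_antisymm h1 (by
        rwa [show (-((n + 1 : ℕ) : ℤ)) + 1 = -n by push_cast; ring] at h2)
      rw [this]; simp
    rw [setIntegral_congr_fun ((meas_pB _).diff (meas_pB _)) this, setIntegral_const,
      measureReal_sdiff (sub (by simp)) (meas_pB _) (fin_pB μ _), measure_pB μ hμ, measure_pB μ hμ]
    have hpc : (p : ℂ) ≠ 0 := by exact_mod_cast hp
    simp only [zpow_neg, zpow_natCast, Complex.real_smul]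
    push_cast
    field_simp
    ring
end

/-- Vladimirov's formula for the Fourier transform of `−log|x|_p` as a distribution:
for locally constant compactly supported `φ`, the function `ξ ↦ −log|ξ|_p·(𝓕φ)(ξ)`
is integrable and
`∫ (−log|ξ|_p)·(𝓕φ)(ξ) dμ(ξ)
  = (log p/(1 − 1/p))·(∫_{|t|≤1} (φ(t) − φ(0))·|t|_p⁻¹ dμ + ∫_{|t|>1} φ(t)·|t|_p⁻¹ dμ + (1/p)·φ(0))`. -/
theorem vladimirov_formula [MeasurableSpace ℚ_[p]] [BorelSpace ℚ_[p]]
    (μ : Measure ℚ_[p]) [μ.IsAddHaarMeasure] (hμ : μ {x : ℚ_[p] | ‖x‖ ≤ 1} = 1)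
    (e : AddChar ℚ_[p] Circle) (he : Continuous e)
    (he1 : ∀ x : ℤ_[p], e (x : ℚ_[p]) = 1)
    (he2 : ∃ x : ℚ_[p], ‖x‖ ≤ p ∧ e x ≠ 1)
    (φ : ℚ_[p] → ℂ) (hφlc : IsLocallyConstant φ) (hφcs : HasCompactSupport φ) :
    Integrable (fun ξ : ℚ_[p] => -(Real.log ‖ξ‖ : ℂ) * padicFourier μ e φ ξ) μ ∧
    (∫ ξ : ℚ_[p], -(Real.log ‖ξ‖ : ℂ) * padicFourier μ e φ ξ ∂μ) =
      ((Real.log p / (1 - 1 / (p : ℝ)) : ℝ) : ℂ) *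
        ((∫ t in {t : ℚ_[p] | ‖t‖ ≤ 1}, (φ t - φ 0) * ((‖t‖⁻¹ : ℝ) : ℂ) ∂μ) +
         (∫ t in {t : ℚ_[p] | 1 < ‖t‖}, φ t * ((‖t‖⁻¹ : ℝ) : ℂ) ∂μ) +
         (1 / (p : ℂ)) * φ 0) := by
  classical
  obtain ⟨n, hn⟩ := exists_level φ hφlc hφcs
  have hφc : Continuous φ := hφlc.continuous
  have hφI : Integrable φ μ := hφc.integrable_of_hasCompactSupport hφcs
  have hlogI : Integrable (fun ξ : ℚ_[p] => -(Real.log ‖ξ‖ : ℂ)) (μ.restrict (pB p n)) := by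
    have h : Integrable (fun ξ : ℚ_[p] => -Real.log ‖ξ‖) (μ.restrict (pB p n)) :=
      integrableOn_log μ hμ n
    simpa using h.ofReal (𝕜 := ℂ)
  have hec : Continuous (fun z : ℚ_[p] × ℚ_[p] => (e (z.2 * z.1) : ℂ)) := by fun_prop
  have hprod : Integrable (fun z : ℚ_[p] × ℚ_[p] =>
      -(Real.log ‖z.1‖ : ℂ) * φ z.2 * (e (z.2 * z.1) : ℂ)) ((μ.restrict (pB p n)).prod μ) :=
    (hlogI.mul_prod hφI).mul_bdd (c := 1) hec.aestronglyMeasurable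
      (Filter.Eventually.of_forall fun ξ => (Circle.norm_coe _).le)
  have hF : ∀ ξ : ℚ_[p], -(Real.log ‖ξ‖ : ℂ) * padicFourier μ e φ ξ =
      ∫ t, -(Real.log ‖ξ‖ : ℂ) * φ t * (e (t * ξ) : ℂ) ∂μ := by
    intro ξ
    rw [padicFourier, ← integral_const_mul]
    simp only [mul_assoc]
  have hz : ∀ ξ : ℚ_[p], ξ ∉ pB p n → -(Real.log ‖ξ‖ : ℂ) * padicFourier μ e φ ξ = 0 := by
    intro ξ hξ
    rw [fourier_supp μ he2 φ n hn ξ hξ, mul_zero]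
  constructor
  · rw [← integrableOn_iff_integrable_of_support_subset (s := pB p n)]
    · have := hprod.integral_prod_left
      simp only [← hF] at this
      exact this
    · intro ξ hξ
      by_contra h
      exact hξ (hz ξ h)
  have hp := (p_pos' (p := p)).ne'
  have h1p : 1 - 1 / (p : ℝ) ≠ 0 := by
    have : 1 / (p : ℝ) < 1 := by rw [div_lt_one p_pos']; exact p_one'
    linarith
  set c : ℝ := Real.log p / (1 - 1 / (p : ℝ)) with hcdef
  have e1 : (∫ ξ : ℚ_[p], -(Real.log ‖ξ‖ : ℂ) * padicFourier μ e φ ξ ∂μ) =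
      ∫ t, φ t * ∫ ξ in pB p n, -(Real.log ‖ξ‖ : ℂ) * (e (t * ξ) : ℂ) ∂μ ∂μ := by
    rw [← setIntegral_eq_integral_of_forall_compl_eq_zero (s := pB p n) hz]
    simp only [hF]
    rw [integral_integral_swap hprod]
    congr 1
    ext t
    rw [← integral_const_mul]
    congr 1
    ext ξ
    ring
  have hK : Integrable (fun t => φ t * ∫ ξ in pB p n, -(Real.log ‖ξ‖ : ℂ) * (e (t * ξ) : ℂ) ∂μ) μ := by
    have := hprod.integral_prod_right
    refine this.congr (Filter.Eventually.of_forall fun t => ?_)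
    dsimp only
    rw [← integral_const_mul]
    congr 1
    ext ξ
    ring
  simp only [kernel_eq μ hμ he he1 he2 n] at e1 hK
  rw [e1, ← integral_add_compl (meas_pB (-n)) hK]
  have hφ0 : ∀ t ∈ pB p (-n), φ t = φ 0 := fun t ht => by simpa using hn 0 t ht
  have i1 : ∀ t ∈ pB p (-n), (φ t * if ‖t‖ ≤ (p : ℝ) ^ (-(n : ℤ)) then
        ((Real.log p * ((p : ℝ) ^ ((n : ℤ) - 1) / (1 - 1 / (p : ℝ)) - (n : ℤ) * (p : ℝ) ^ (n : ℤ)) : ℝ) : ℂ)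
      else ((c * ‖t‖⁻¹ : ℝ) : ℂ)) = φ 0 *
      ((Real.log p * ((p : ℝ) ^ ((n : ℤ) - 1) / (1 - 1 / (p : ℝ)) - (n : ℤ) * (p : ℝ) ^ (n : ℤ)) : ℝ) : ℂ) := by
    intro t ht
    rw [if_pos (mem_pB.1 ht), hφ0 t ht]
  have i2 : ∀ t ∈ (pB p (-n))ᶜ, (φ t * if ‖t‖ ≤ (p : ℝ) ^ (-(n : ℤ)) then
        ((Real.log p * ((p : ℝ) ^ ((n : ℤ) - 1) / (1 - 1 / (p : ℝ)) - (n : ℤ) * (p : ℝ) ^ (n : ℤ)) : ℝ) : ℂ)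
      else ((c * ‖t‖⁻¹ : ℝ) : ℂ)) = (c : ℂ) * (φ t * ((‖t‖⁻¹ : ℝ) : ℂ)) := by
    intro t ht
    rw [if_neg (fun h => ht (mem_pB.2 h))]
    push_cast; ring
  rw [setIntegral_congr_fun (meas_pB (-n)) i1, setIntegral_congr_fun (meas_pB (-n)).compl i2,
    setIntegral_const, integral_const_mul, measure_pB μ hμ]
  have hinvm : ∀ ν : Measure ℚ_[p], AEStronglyMeasurable (fun t : ℚ_[p] => ((‖t‖⁻¹ : ℝ) : ℂ)) ν :=
    fun ν => (Complex.measurable_ofReal.comp measurable_norm.inv).aestronglyMeasurable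
  have hbd : ∀ t ∈ (pB p (-n))ᶜ, ‖((‖t‖⁻¹ : ℝ) : ℂ)‖ ≤ ((p : ℝ) ^ (-(n : ℤ) + 1))⁻¹ := by
    intro t ht
    have := not_le_zpow ht
    have h4 := zpow_pos (p_pos' (p := p)) (-(n : ℤ) + 1)
    simp only [Complex.norm_real, norm_inv, norm_norm]
    gcongr
  have hI : ∀ f : ℚ_[p] → ℂ, ∀ s : Set ℚ_[p], MeasurableSet s → s ⊆ (pB p (-n))ᶜ →
      IntegrableOn f s μ → IntegrableOn (fun t => f t * ((‖t‖⁻¹ : ℝ) : ℂ)) s μ := by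
    intro f s hs hss hf
    refine Integrable.mul_bdd hf (c := ((p : ℝ) ^ (-(n : ℤ) + 1))⁻¹) (hinvm _) ?_
    filter_upwards [ae_restrict_mem hs] with t ht
    exact hbd t (hss ht)
  have sub0 : pB p (-n) ⊆ pB p 0 := fun x hx =>
    le_trans (mem_pB.1 hx) (zpow_le_zpow_right₀ p_one'.le (by simp))
  have hB0 : {t : ℚ_[p] | ‖t‖ ≤ 1} = pB p 0 := by ext; simp [pB]
  have hB1 : {t : ℚ_[p] | 1 < ‖t‖} = (pB p 0)ᶜ := by ext; simp [pB]
  have hmA : MeasurableSet (pB p 0 \ pB p (-n)) := (meas_pB 0).diff (meas_pB _)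
  have hA : (pB p (-n))ᶜ = (pB p 0 \ pB p (-n)) ∪ (pB p 0)ᶜ := by
    ext x
    have := @sub0 x
    simp only [Set.mem_compl_iff, Set.mem_union, Set.mem_sdiff]
    tauto
  have hAs : pB p 0 \ pB p (-n) ⊆ (pB p (-n))ᶜ := fun x hx => hx.2
  have hfinA : μ (pB p 0 \ pB p (-n)) ≠ ⊤ :=
    measure_ne_top_of_subset Set.sdiff_subset (fin_pB μ 0)
  have e2 : ∫ t in (pB p (-n))ᶜ, φ t * ((‖t‖⁻¹ : ℝ) : ℂ) ∂μ =
      ∫ t in pB p 0 \ pB p (-n), φ t * ((‖t‖⁻¹ : ℝ) : ℂ) ∂μ +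
      ∫ t in (pB p 0)ᶜ, φ t * ((‖t‖⁻¹ : ℝ) : ℂ) ∂μ := by
    rw [hA, setIntegral_union (disjoint_compl_right.mono_left Set.sdiff_subset) (meas_pB 0).compl
      (hI _ _ hmA hAs hφI.integrableOn)
      (hI _ _ (meas_pB 0).compl (Set.compl_subset_compl.2 sub0) hφI.integrableOn)]
  have e3 : ∫ t in pB p 0 \ pB p (-n), φ t * ((‖t‖⁻¹ : ℝ) : ℂ) ∂μ =
      ∫ t in pB p 0 \ pB p (-n), (φ t - φ 0) * ((‖t‖⁻¹ : ℝ) : ℂ) ∂μ +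
        φ 0 * (n * (1 - 1 / (p : ℂ))) := by
    rw [← int_inv_norm μ hμ n, ← integral_const_mul, ← integral_add]
    · congr 1
      ext t
      ring
    · exact hI _ _ hmA hAs (hφI.integrableOn.sub (integrableOn_const hfinA))
    · exact hI (fun _ => φ 0) _ hmA hAs (integrableOn_const hfinA)
  have e4 : ∫ t in pB p 0, (φ t - φ 0) * ((‖t‖⁻¹ : ℝ) : ℂ) ∂μ =
      ∫ t in pB p 0 \ pB p (-n), (φ t - φ 0) * ((‖t‖⁻¹ : ℝ) : ℂ) ∂μ := by
    refine setIntegral_eq_of_subset_of_forall_sdiff_eq_zero (meas_pB 0) Set.sdiff_subset ?_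
    intro t ht
    have : t ∈ pB p (-n) := by
      by_contra h
      exact ht.2 ⟨ht.1, h⟩
    rw [hφ0 t this, sub_self, zero_mul]
  rw [hB0, hB1, e2, e3, e4]
  have hpc : (p : ℂ) ≠ 0 := by exact_mod_cast hp
  have hcc : (c : ℂ) * (1 - 1 / (p : ℂ)) = (Real.log p : ℂ) := by
    have : c * (1 - 1 / (p : ℝ)) = Real.log p := div_mul_cancel₀ _ h1p
    have h := congrArg (fun x : ℝ => (x : ℂ)) this
    push_cast at h ⊢
    exact h
  have hc2 : ((p : ℝ) ^ (-(n : ℤ))) *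
      (Real.log p * ((p : ℝ) ^ ((n : ℤ) - 1) / (1 - 1 / (p : ℝ)) - (n : ℤ) * (p : ℝ) ^ (n : ℤ))) =
      c * (1 / p) - n * Real.log p := by
    have hpn : (p : ℝ) ^ n ≠ 0 := pow_ne_zero _ hp
    have ha : ((p : ℝ) ^ (-(n : ℤ))) * (p : ℝ) ^ ((n : ℤ) - 1) = 1 / p := by
      rw [← zpow_add₀ hp, show -(n : ℤ) + ((n : ℤ) - 1) = -1 by ring]; simp
    have hb : ((p : ℝ) ^ (-(n : ℤ))) * (p : ℝ) ^ (n : ℤ) = 1 := by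
      rw [← zpow_add₀ hp]; simp
    rw [hcdef]
    push_cast at ha hb ⊢
    linear_combination (Real.log p / (1 - 1 / (p : ℝ))) * ha - n * Real.log p * hb
  have hc3 : ((p : ℝ) ^ (-(n : ℤ))) • (φ 0 *
      ((Real.log p * ((p : ℝ) ^ ((n : ℤ) - 1) / (1 - 1 / (p : ℝ)) - (n : ℤ) * (p : ℝ) ^ (n : ℤ)) : ℝ) : ℂ)) =
      φ 0 * ((c : ℂ) * (1 / p) - n * (Real.log p : ℂ)) := by
    have := congrArg (fun x : ℝ => (x : ℂ)) hc2
    rw [Complex.ofReal_mul] at this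
    rw [Complex.real_smul, mul_left_comm, this]
    push_cast; ring
  rw [hc3]
  linear_combination (φ 0 * n) * hcc
end

section
/- Let θ : ℚ_p → ℂ be the indicator function of the unit group ℤ_pˣ = {t : |t|_p = 1}. Then the conductor operator applied to θ satisfies: H(θ)(t) = −log(p) for |t|_p < 1; H(θ)(t) = 0 for |t|_p = 1; and H(θ)(t) = −log(p)/|t|_p for |t|_p > 1. -/
open MeasureTheory Complex

variable {p : ℕ} [Fact p.Prime]

open scoped ENNReal

section aux
set_option linter.unusedSectionVars false
variable [MeasurableSpace ℚ_[p]] [BorelSpace ℚ_[p]]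

lemma aux_ppos : (0:ℝ) < p := by exact_mod_cast (Fact.out : p.Prime).pos
lemma aux_pne : (p:ℚ_[p]) ≠ 0 := by exact_mod_cast (Fact.out : p.Prime).ne_zero

lemma aux_lt_one_iff (x : ℚ_[p]) : ‖x‖ < 1 ↔ ‖x‖ ≤ (p:ℝ)⁻¹ := by
  have := Padic.norm_lt_pow_iff_norm_le_pow_sub_one x 0
  simpa using this

lemma aux_meas (r : ℝ) : MeasurableSet {x : ℚ_[p] | ‖x‖ ≤ r} :=
  measurableSet_le measurable_norm measurable_const

lemma aux_ball (μ : Measure ℚ_[p]) [μ.IsAddHaarMeasure] (hμ : μ {x : ℚ_[p] | ‖x‖ ≤ 1} = 1) :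
    (p : ℝ≥0∞) * μ {x : ℚ_[p] | ‖x‖ ≤ (p:ℝ)⁻¹} = 1 := by
  have hU : {x : ℚ_[p] | ‖x‖ ≤ 1} =
      ⋃ i ∈ Finset.range p, (fun x => -(i:ℚ_[p]) + x) ⁻¹' {x : ℚ_[p] | ‖x‖ ≤ (p:ℝ)⁻¹} := by
    ext x
    simp only [Set.mem_ofPred_eq, Set.mem_iUnion, Set.mem_preimage, Finset.mem_range, exists_prop]
    constructor
    · intro hx
      obtain ⟨n, hn, h⟩ := PadicInt.exists_mem_range (⟨x, hx⟩ : ℤ_[p])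
      refine ⟨n, hn, ?_⟩
      rw [← aux_lt_one_iff]
      rw [IsLocalRing.mem_maximalIdeal, PadicInt.mem_nonunits] at h
      rw [neg_add_eq_sub]
      rw [PadicInt.norm_def] at h
      exact h
    · rintro ⟨i, hi, h⟩
      rw [← aux_lt_one_iff] at h
      have h2 : x = (i:ℚ_[p]) + (-(i:ℚ_[p]) + x) := by ring
      rw [h2]
      refine (Padic.nonarchimedean _ _).trans (max_le ?_ h.le)
      exact_mod_cast Padic.norm_int_le_one (p := p) i
  rw [hU, measure_biUnion_finset] at hμ
  · simp only [measure_preimage_add, Finset.sum_const, Finset.card_range, nsmul_eq_mul] at hμ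
    exact hμ
  · intro i hi j hj hij
    rw [Function.onFun, Set.disjoint_left]
    intro x h1 h2
    simp only [Set.mem_ofPred_eq, Set.mem_preimage] at h1 h2
    rw [← aux_lt_one_iff] at h1 h2
    have h3 : ‖(((i:ℤ) - (j:ℤ) : ℤ) : ℚ_[p])‖ < 1 := by
      have : (((i:ℤ) - (j:ℤ) : ℤ) : ℚ_[p]) = (-(j:ℚ_[p]) + x) - (-(i:ℚ_[p]) + x) := by
        push_cast; ring
      rw [this]
      rw [sub_eq_add_neg]
      exact (Padic.nonarchimedean _ _).trans_lt (max_lt h2 (by rwa [norm_neg]))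
    rw [Padic.norm_intCast_lt_one_iff] at h3
    apply hij
    simp at hi hj
    have := Int.eq_zero_of_abs_lt_dvd h3 (by rw [abs_lt]; constructor <;> omega)
    omega
  · intro i _
    exact (measurable_const_add _) (aux_meas _)

lemma aux_map (μ : Measure ℚ_[p]) [μ.IsAddHaarMeasure] (hμ : μ {x : ℚ_[p] | ‖x‖ ≤ 1} = 1) :
    μ.map (fun x => (p:ℚ_[p]) * x) = (p : ℝ≥0∞) • μ := by
  let f : ℚ_[p] ≃+ ℚ_[p] := AddEquiv.mk' (Equiv.mulLeft₀ (p:ℚ_[p]) aux_pne) (by intro a b; simp [mul_add])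
  have hf : (f : ℚ_[p] → ℚ_[p]) = fun x => (p:ℚ_[p]) * x := rfl
  have hfs : (f.symm : ℚ_[p] → ℚ_[p]) = fun x => (p:ℚ_[p])⁻¹ * x := rfl
  have h1 : (μ.map f).IsAddHaarMeasure :=
    f.isAddHaarMeasure_map μ (by rw [hf]; fun_prop) (by rw [hfs]; fun_prop)
  rw [hf] at h1
  have h2 := Measure.isAddLeftInvariant_eq_smul (μ.map (fun x => (p:ℚ_[p]) * x)) μ
  set c := Measure.addHaarScalarFactor (μ.map (fun x => (p:ℚ_[p]) * x)) μ
  have h3 := congrArg (fun m : Measure ℚ_[p] => m {x : ℚ_[p] | ‖x‖ ≤ (p:ℝ)⁻¹}) h2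
  beta_reduce at h3
  rw [Measure.map_apply (by fun_prop) (aux_meas _)] at h3
  have h4 : (fun x => (p:ℚ_[p]) * x) ⁻¹' {x : ℚ_[p] | ‖x‖ ≤ (p:ℝ)⁻¹} = {x : ℚ_[p] | ‖x‖ ≤ 1} := by
    ext x
    have := aux_ppos (p := p)
    simp only [Set.mem_preimage, Set.mem_ofPred_eq, norm_mul, Padic.norm_p]
    rw [mul_le_iff_le_one_right (by positivity)]
  rw [h4, hμ] at h3
  have h5 := aux_ball μ hμ
  have h6 : (c : ℝ≥0∞) = p := by
    have h3' : (c : ℝ≥0∞) * μ {x : ℚ_[p] | ‖x‖ ≤ (p:ℝ)⁻¹} = 1 := by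
      rw [h3]; rfl
    rw [ENNReal.eq_inv_of_mul_eq_one_left h3', ENNReal.eq_inv_of_mul_eq_one_left h5]
  rw [h2, ← h6]
  rfl

lemma aux_emb : MeasurableEmbedding (fun x => (p:ℚ_[p]) * x) :=
  measurableEmbedding_mulLeft₀ aux_pne

lemma aux_int (μ : Measure ℚ_[p]) [μ.IsAddHaarMeasure] (hμ : μ {x : ℚ_[p] | ‖x‖ ≤ 1} = 1)
    (f : ℚ_[p] → ℂ) : ∫ x, f (p * x) ∂μ = p * ∫ x, f x ∂μ := by
  rw [← aux_emb.integral_map (g := f), aux_map μ hμ, integral_smul_measure]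
  simp

lemma aux_integrable (μ : Measure ℚ_[p]) [μ.IsAddHaarMeasure]
    (hμ : μ {x : ℚ_[p] | ‖x‖ ≤ 1} = 1)
    (f : ℚ_[p] → ℂ) (hf : Integrable f μ) : Integrable (fun x => f (p * x)) μ := by
  have := (aux_emb (p := p)).integrable_map_iff (μ := μ) (g := f)
  rw [aux_map μ hμ] at this
  exact this.1 (hf.smul_measure (by simp))

lemma aux_ballk (μ : Measure ℚ_[p]) [μ.IsAddHaarMeasure] (hμ : μ {x : ℚ_[p] | ‖x‖ ≤ 1} = 1)
    (k : ℕ) : μ {x : ℚ_[p] | ‖x‖ ≤ (p:ℝ)⁻¹ ^ k} = (p:ℝ≥0∞)⁻¹ ^ k := by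
  have hp := aux_ppos (p := p)
  induction k with
  | zero => simpa using hμ
  | succ k ih =>
    have h := congrArg (fun m : Measure ℚ_[p] => m {x : ℚ_[p] | ‖x‖ ≤ (p:ℝ)⁻¹ ^ (k+1)}) (aux_map μ hμ)
    beta_reduce at h
    rw [Measure.map_apply (by fun_prop) (aux_meas _)] at h
    have h4 : (fun x => (p:ℚ_[p]) * x) ⁻¹' {x : ℚ_[p] | ‖x‖ ≤ (p:ℝ)⁻¹ ^ (k+1)}
        = {x : ℚ_[p] | ‖x‖ ≤ (p:ℝ)⁻¹ ^ k} := by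
      ext x
      simp only [Set.mem_preimage, Set.mem_ofPred_eq, norm_mul, Padic.norm_p]
      rw [pow_succ', mul_le_mul_iff_right₀ (by positivity)]
    rw [h4, ih, Measure.smul_apply, smul_eq_mul] at h
    have hp0 : (p:ℝ≥0∞) ≠ 0 := by exact_mod_cast (Fact.out : p.Prime).ne_zero
    rw [pow_succ' ((p:ℝ≥0∞)⁻¹), h, ← mul_assoc, ENNReal.inv_mul_cancel hp0 (by simp), one_mul]

/-- indicator of the integers -/
noncomputable def auxB (x : ℚ_[p]) : ℂ := if ‖x‖ ≤ 1 then 1 else 0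

/-- truncated logarithm -/
noncomputable def auxL (x : ℚ_[p]) : ℂ := (Real.log ‖x‖ : ℂ) * auxB x

lemma aux_Bmeas : Measurable (auxB (p := p)) :=
  Measurable.ite (aux_meas 1) measurable_const measurable_const

lemma aux_Bint (μ : Measure ℚ_[p]) [μ.IsAddHaarMeasure] (hμ : μ {x : ℚ_[p] | ‖x‖ ≤ 1} = 1) :
    Integrable auxB μ := by
  have : auxB (p := p) = Set.indicator {x : ℚ_[p] | ‖x‖ ≤ 1} (fun _ => (1:ℂ)) := by
    ext x; simp [auxB, Set.indicator]
  rw [this, integrable_indicator_iff (aux_meas 1)]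
  exact integrableOn_const (by simp [hμ])

lemma aux_Lint (μ : Measure ℚ_[p]) [μ.IsAddHaarMeasure] (hμ : μ {x : ℚ_[p] | ‖x‖ ≤ 1} = 1) :
    Integrable auxL μ := by
  have hp := aux_ppos (p := p)
  have hp1 : (1:ℝ) < p := by exact_mod_cast (Fact.out : p.Prime).one_lt
  have hlog : 0 < Real.log p := Real.log_pos hp1
  refine ⟨?_, ?_⟩
  · apply Measurable.aestronglyMeasurable
    unfold auxL
    exact (Complex.measurable_ofReal.comp (Real.measurable_log.comp measurable_norm)).mul aux_Bmeas
  · rw [hasFiniteIntegral_iff_enorm]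
    have hle : ∀ x : ℚ_[p], ‖auxL x‖ₑ ≤ ∑' k : ℕ, Set.indicator {x : ℚ_[p] | ‖x‖ ≤ (p:ℝ)⁻¹ ^ k}
        (fun _ => ENNReal.ofReal (Real.log p)) x := by
      intro x
      by_cases hx0 : x = 0
      · simp [hx0, auxL]
      by_cases hx : ‖x‖ ≤ 1
      · obtain ⟨n, hn⟩ := Int.eq_ofNat_of_zero_le ((Padic.norm_le_one_iff_val_nonneg x).1 hx)
        have hnx : ‖x‖ = (p:ℝ)⁻¹ ^ n := by
          rw [Padic.norm_eq_zpow_neg_valuation hx0, hn]; simp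
        refine le_trans ?_ (ENNReal.sum_le_tsum (Finset.range n))
        rw [Finset.sum_congr rfl (g := fun _ => ENNReal.ofReal (Real.log p))]
        · simp only [auxL, auxB, hx, if_true, mul_one, Finset.sum_const, Finset.card_range]
          rw [hnx, ← ofReal_norm, Complex.norm_real, Real.log_pow, Real.log_inv, norm_mul, norm_neg,
            Real.norm_of_nonneg hlog.le, ENNReal.ofReal_mul (norm_nonneg _)]
          simp
        · intro k hk
          rw [Set.indicator_of_mem]
          simp only [Set.mem_ofPred_eq, hnx]
          exact pow_le_pow_of_le_one (by positivity) (inv_le_one_of_one_le₀ hp1.le)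
            (Finset.mem_range.1 hk).le
      · simp [auxL, auxB, hx]
    refine (lintegral_mono hle).trans_lt ?_
    rw [lintegral_tsum (fun k => (measurable_const.indicator (aux_meas _)).aemeasurable)]
    simp_rw [lintegral_indicator_const (aux_meas _), aux_ballk μ hμ]
    rw [ENNReal.tsum_mul_left, ENNReal.tsum_geometric]
    refine ENNReal.mul_lt_top (by simp) ?_
    rw [ENNReal.inv_lt_top, tsub_pos_iff_lt, ENNReal.inv_lt_one]
    exact_mod_cast (Fact.out : p.Prime).one_lt

lemma aux_mul_int (μ : Measure ℚ_[p]) (e : AddChar ℚ_[p] Circle) (he : Continuous e) (t : ℚ_[p])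
    (f : ℚ_[p] → ℂ) (hf : Integrable f μ) : Integrable (fun x => f x * (e (t * x) : ℂ)) μ := by
  refine hf.mul_bdd (c := 1) ?_ (by filter_upwards with x; exact (Circle.norm_coe _).le)
  exact Continuous.aestronglyMeasurable (by fun_prop)

lemma aux_A (μ : Measure ℚ_[p]) [μ.IsAddHaarMeasure] (hμ : μ {x : ℚ_[p] | ‖x‖ ≤ 1} = 1)
    (e : AddChar ℚ_[p] Circle)
    (he1 : ∀ x : ℤ_[p], e (x : ℚ_[p]) = 1)
    (he2 : ∃ x : ℚ_[p], ‖x‖ ≤ p ∧ e x ≠ 1) (t : ℚ_[p]) :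
    ∫ x, auxB x * (e (t * x) : ℂ) ∂μ = auxB t := by
  by_cases ht : ‖t‖ ≤ 1
  · have : (fun x => auxB x * (e (t * x) : ℂ)) = Set.indicator {x : ℚ_[p] | ‖x‖ ≤ 1} (fun _ => (1:ℂ)) := by
      ext x
      by_cases hx : ‖x‖ ≤ 1
      · have h := he1 ⟨t * x, by rw [norm_mul]; exact mul_le_one₀ ht (norm_nonneg _) hx⟩
        simp only at h
        simp [auxB, hx, h]
      · simp [auxB, hx]
    rw [this, integral_indicator_const _ (aux_meas 1)]
    simp [auxB, ht, Measure.real, hμ]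
  · push Not at ht
    obtain ⟨x0, hx0, hex⟩ := he2
    have ht0 : t ≠ 0 := by rintro rfl; simp at ht; linarith
    have htp : (p:ℝ) ≤ ‖t‖ := by
      have := Padic.norm_lt_pow_iff_norm_le_pow_sub_one t 1
      simp at this
      by_contra h; push Not at h
      exact absurd (this.1 h) (by linarith)
    set y := x0 / t with hy
    have hy1 : ‖y‖ ≤ 1 := by
      rw [hy, norm_div]
      exact div_le_one_of_le₀ (hx0.trans htp) (norm_nonneg _)
    have hty : t * y = x0 := by rw [hy]; field_simp
    have hB : ∀ x, auxB (y + x) = auxB x := by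
      intro x
      have : ‖y + x‖ ≤ 1 ↔ ‖x‖ ≤ 1 := by
        constructor
        · intro h
          have h2 : x = -y + (y + x) := by ring
          rw [h2]
          exact (Padic.nonarchimedean _ _).trans (max_le (by simpa using hy1) h)
        · intro h
          exact (Padic.nonarchimedean _ _).trans (max_le hy1 h)
      simp [auxB, this]
    have h := integral_add_left_eq_self (μ := μ) (fun x => auxB x * (e (t * x) : ℂ)) y
    simp only [hB, mul_add, AddChar.map_add_eq_mul, hty, Circle.coe_mul] at h
    have h2 : (e x0 : ℂ) * ∫ x, auxB x * (e (t * x) : ℂ) ∂μ = ∫ x, auxB x * (e (t * x) : ℂ) ∂μ := by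
      rw [← integral_const_mul, ← h]
      congr 1; ext x; ring
    have h3 : (e x0 : ℂ) ≠ 1 := by
      intro h; apply hex; exact Circle.ext (by rw [h]; rfl)
    rw [auxB, if_neg (by linarith)]
    by_contra h4
    exact h3 (mul_right_cancel₀ h4 (by rw [h2, one_mul]))

lemma aux_le_p (x : ℚ_[p]) (h : ¬ ‖x‖ ≤ 1) (h2 : ‖(p:ℚ_[p]) * x‖ ≤ 1) : ‖x‖ = p := by
  have hp := aux_ppos (p := p)
  rw [norm_mul, Padic.norm_p] at h2
  have := Padic.norm_lt_pow_iff_norm_le_pow_sub_one x 1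
  simp at this
  have h3 : (p:ℝ) ≤ ‖x‖ := by
    by_contra h4; push Not at h4
    exact h (this.1 h4)
  refine le_antisymm ?_ h3
  rwa [inv_mul_le_iff₀ hp, mul_one] at h2

lemma aux_log (x : ℚ_[p]) (hx : x ≠ 0) :
    Real.log ‖(p:ℚ_[p]) * x‖ = Real.log ‖x‖ - Real.log p := by
  have hp := aux_ppos (p := p)
  rw [norm_mul, Padic.norm_p, Real.log_mul (by positivity) (by simpa using hx), Real.log_inv]; ring

lemma aux_B_of (x : ℚ_[p]) (h : ‖x‖ ≤ 1) : auxB ((p:ℚ_[p]) * x) = 1 := by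
  rw [auxB, if_pos]
  rw [norm_mul]
  exact mul_le_one₀ (Padic.norm_p_lt_one.le) (norm_nonneg _) h

lemma aux_L_eq (x : ℚ_[p]) (hx : x ≠ 0) :
    auxL ((p:ℚ_[p]) * x) = auxL x - Real.log p * auxB x := by
  unfold auxL
  rw [aux_log x hx]
  by_cases h : ‖x‖ ≤ 1
  · rw [aux_B_of x h]; simp [auxB, h]
  · by_cases h2 : ‖(p:ℚ_[p]) * x‖ ≤ 1
    · rw [aux_le_p x h h2]; simp [auxB, h]
    · simp only [auxB, h, h2]; simp

/-- Fourier transform of the truncated logarithm -/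
noncomputable def auxG (μ : Measure ℚ_[p]) (e : AddChar ℚ_[p] Circle) (t : ℚ_[p]) : ℂ :=
  ∫ x, auxL x * (e (t * x) : ℂ) ∂μ

lemma aux_ne (μ : Measure ℚ_[p]) [μ.IsAddHaarMeasure] : ∀ᵐ x ∂μ, x ≠ 0 := by
  simp [ae_iff]

lemma aux_G (μ : Measure ℚ_[p]) [μ.IsAddHaarMeasure] (hμ : μ {x : ℚ_[p] | ‖x‖ ≤ 1} = 1)
    (e : AddChar ℚ_[p] Circle) (he : Continuous e)
    (he1 : ∀ x : ℤ_[p], e (x : ℚ_[p]) = 1)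
    (he2 : ∃ x : ℚ_[p], ‖x‖ ≤ p ∧ e x ≠ 1) (t : ℚ_[p]) :
    p * auxG μ e t = auxG μ e (p * t) - Real.log p * auxB ((p:ℚ_[p]) * t) := by
  unfold auxG
  rw [← aux_int μ hμ, ← aux_A μ hμ e he1 he2, ← integral_const_mul, ← integral_sub]
  · apply integral_congr_ae
    filter_upwards [aux_ne μ] with x hx
    rw [aux_L_eq x hx]
    have : t * (p * x) = p * t * x := by ring
    rw [this]; ring
  · exact aux_mul_int μ e he _ _ (aux_Lint μ hμ)
  · exact (aux_mul_int μ e he _ _ (aux_Bint μ hμ)).const_mul _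

lemma aux_G_one (μ : Measure ℚ_[p]) (e : AddChar ℚ_[p] Circle)
    (he1 : ∀ x : ℤ_[p], e (x : ℚ_[p]) = 1) (t : ℚ_[p]) (ht : ‖t‖ ≤ 1) :
    auxG μ e t = auxG μ e 0 := by
  unfold auxG
  congr 1; ext x
  by_cases hx : ‖x‖ ≤ 1
  · have h := he1 ⟨t * x, by rw [norm_mul]; exact mul_le_one₀ ht (norm_nonneg _) hx⟩
    simp only at h
    simp [h]
  · simp [auxL, auxB, hx]

lemma aux_theta (μ : Measure ℚ_[p]) [μ.IsAddHaarMeasure] (hμ : μ {x : ℚ_[p] | ‖x‖ ≤ 1} = 1)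
    (e : AddChar ℚ_[p] Circle) (he : Continuous e)
    (he1 : ∀ x : ℤ_[p], e (x : ℚ_[p]) = 1)
    (he2 : ∃ x : ℚ_[p], ‖x‖ ≤ p ∧ e x ≠ 1) (t : ℚ_[p]) :
    (p:ℂ) * padicFourierInv μ e (fun s => if ‖s‖ = 1 then (1 : ℂ) else 0) t
      = p * auxB t - auxB ((p:ℚ_[p]) * t) := by
  have hp := aux_ppos (p := p)
  have hBn : ∀ s : ℚ_[p], auxB (-s) = auxB s := by intro s; simp [auxB]
  unfold padicFourierInv
  rw [← hBn t, ← hBn (p * t), ← aux_A μ hμ e he1 he2, ← aux_A μ hμ e he1 he2, ← aux_int μ hμ,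
    ← aux_int μ hμ, ← integral_sub]
  · congr 1; ext x
    have e1 : -t * (p * x) = -(t * (p * x)) := by ring
    have e2 : -(p * t) * x = -(t * (p * x)) := by ring
    rw [e1, e2, ← sub_mul]
    congr 1
    beta_reduce
    by_cases h : ‖x‖ ≤ 1
    · rw [aux_B_of x h, auxB, if_pos h, if_neg]
      · simp
      · rw [norm_mul]
        have := Padic.norm_p_lt_one (p := p)
        have h0 := norm_nonneg (p : ℚ_[p])
        nlinarith [norm_nonneg x]
    · by_cases h2 : ‖(p:ℚ_[p]) * x‖ ≤ 1
      · have h3 : ‖(p:ℚ_[p]) * x‖ = 1 := by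
          rw [norm_mul, aux_le_p x h h2, Padic.norm_p, inv_mul_cancel₀ hp.ne']
        simp [auxB, h, h3, -norm_mul]
      · have h3 : ¬ ‖(p:ℚ_[p]) * x‖ = 1 := fun h => h2 h.le
        simp [auxB, h, h2, h3, -norm_mul]
  · exact aux_integrable μ hμ (fun y => auxB y * (e (-t * y) : ℂ)) (aux_mul_int μ e he _ _ (aux_Bint μ hμ))
  · exact aux_mul_int μ e he _ _ (aux_Bint μ hμ)

lemma aux_I (μ : Measure ℚ_[p]) [μ.IsAddHaarMeasure] (hμ : μ {x : ℚ_[p] | ‖x‖ ≤ 1} = 1)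
    (e : AddChar ℚ_[p] Circle) (he : Continuous e)
    (he1 : ∀ x : ℤ_[p], e (x : ℚ_[p]) = 1)
    (he2 : ∃ x : ℚ_[p], ‖x‖ ≤ p ∧ e x ≠ 1) (t : ℚ_[p]) :
    ∫ ξ, (Real.log ‖ξ‖ : ℂ) * padicFourierInv μ e (fun s => if ‖s‖ = 1 then (1 : ℂ) else 0) ξ
      * (e (t * ξ) : ℂ) ∂μ = auxG μ e t - auxG μ e (t / p) - Real.log p * auxB (t / (p:ℚ_[p])) := by
  have hpc : (p:ℂ) ≠ 0 := by exact_mod_cast (Fact.out : p.Prime).ne_zero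
  have hpq := aux_pne (p := p)
  apply mul_left_cancel₀ hpc
  rw [← aux_A μ hμ e he1 he2, mul_sub, mul_sub]
  unfold auxG
  rw [mul_left_comm (p:ℂ) (Real.log p : ℂ)]
  rw [← aux_int μ hμ (fun x => auxL x * (e (t / p * x) : ℂ)),
    ← aux_int μ hμ (fun x => auxB x * (e (t / p * x) : ℂ)), ← integral_const_mul,
    ← integral_const_mul, ← integral_const_mul, ← integral_sub, ← integral_sub]
  · apply integral_congr_ae
    filter_upwards [aux_ne μ] with x hx
    have e1 : t / p * (p * x) = t * x := by field_simp
    have h := aux_theta μ hμ e he he1 he2 x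
    have h2 := aux_log x hx
    rw [e1]
    unfold auxL
    rw [h2]
    push_cast
    linear_combination ((Real.log ‖x‖ : ℂ) * (e (t * x) : ℂ)) * h
  · exact ((aux_mul_int μ e he _ _ (aux_Lint μ hμ)).const_mul _).sub
      (aux_integrable μ hμ (fun x => auxL x * (e (t / p * x) : ℂ)) (aux_mul_int μ e he _ _ (aux_Lint μ hμ)))
  · exact (aux_integrable μ hμ (fun x => auxB x * (e (t / p * x) : ℂ)) (aux_mul_int μ e he _ _ (aux_Bint μ hμ))).const_mul _
  · exact (aux_mul_int μ e he _ _ (aux_Lint μ hμ)).const_mul _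
  · exact aux_integrable μ hμ (fun x => auxL x * (e (t / p * x) : ℂ)) (aux_mul_int μ e he _ _ (aux_Lint μ hμ))

lemma aux_G_big (μ : Measure ℚ_[p]) [μ.IsAddHaarMeasure] (hμ : μ {x : ℚ_[p] | ‖x‖ ≤ 1} = 1)
    (e : AddChar ℚ_[p] Circle) (he : Continuous e)
    (he1 : ∀ x : ℤ_[p], e (x : ℚ_[p]) = 1)
    (he2 : ∃ x : ℚ_[p], ‖x‖ ≤ p ∧ e x ≠ 1) (n : ℕ) (t : ℚ_[p]) (ht : ‖t‖ = (p:ℝ) ^ (n+1)) :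
    (p - 1) * (p:ℂ) ^ n * auxG μ e t = - Real.log p := by
  have hp := aux_ppos (p := p)
  have hp1 : (1:ℝ) < p := by exact_mod_cast (Fact.out : p.Prime).one_lt
  have hn : ‖(p:ℚ_[p]) * t‖ = (p:ℝ) ^ n := by
    rw [norm_mul, ht, Padic.norm_p, pow_succ']; field_simp
  have h := aux_G μ hμ e he he1 he2 t
  induction n generalizing t with
  | zero =>
    have h0 := aux_G μ hμ e he he1 he2 0
    have hpc : (p:ℂ) ≠ 0 := by exact_mod_cast hp.ne'
    rw [aux_G_one μ e he1 ((p:ℚ_[p]) * t) (by rw [hn]; simp)] at h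
    simp only [auxB, hn] at h
    simp [auxB] at h h0 ⊢
    apply mul_left_cancel₀ hpc
    linear_combination (p - 1 : ℂ) * h + h0
  | succ n ih =>
    have h3 := ih (p * t) hn (by rw [norm_mul, hn, Padic.norm_p, pow_succ']; field_simp) (aux_G μ hμ e he he1 he2 _)
    have hb : auxB ((p:ℚ_[p]) * t) = 0 := by
      rw [auxB, if_neg]
      rw [hn, not_le]
      exact one_lt_pow₀ hp1 (by simp)
    rw [hb] at h
    rw [pow_succ]
    linear_combination h3 + (p - 1 : ℂ) * p ^ n * h

end aux

/-- The conductor operator applied to the indicator `θ` of the unit group: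
`H(θ)(t) = −log p` for `|t|_p < 1`, `H(θ)(t) = 0` for `|t|_p = 1`,
and `H(θ)(t) = −log(p)/|t|_p` for `|t|_p > 1`. -/
theorem conductor_of_unit_indicator [MeasurableSpace ℚ_[p]] [BorelSpace ℚ_[p]]
    (μ : Measure ℚ_[p]) [μ.IsAddHaarMeasure] (hμ : μ {x : ℚ_[p] | ‖x‖ ≤ 1} = 1)
    (e : AddChar ℚ_[p] Circle) (he : Continuous e)
    (he1 : ∀ x : ℤ_[p], e (x : ℚ_[p]) = 1)
    (he2 : ∃ x : ℚ_[p], ‖x‖ ≤ p ∧ e x ≠ 1) (t : ℚ_[p]) :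
    (‖t‖ < 1 → padicCondOp μ e (fun s => if ‖s‖ = 1 then (1 : ℂ) else 0) t
        = ((-Real.log p : ℝ) : ℂ)) ∧
    (‖t‖ = 1 → padicCondOp μ e (fun s => if ‖s‖ = 1 then (1 : ℂ) else 0) t = 0) ∧
    (1 < ‖t‖ → padicCondOp μ e (fun s => if ‖s‖ = 1 then (1 : ℂ) else 0) t
        = ((-Real.log p / ‖t‖ : ℝ) : ℂ)) := by
  have hp := aux_ppos (p := p)
  have hp1 : (1:ℝ) < p := by exact_mod_cast (Fact.out : p.Prime).one_lt
  have hpc : (p:ℂ) ≠ 0 := by exact_mod_cast hp.ne'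
  have hpc1 : (p:ℂ) - 1 ≠ 0 := by
    rw [sub_ne_zero]; exact_mod_cast hp1.ne'
  have hI := aux_I μ hμ e he he1 he2 t
  have hnorm : ‖t / p‖ = p * ‖t‖ := by rw [norm_div, Padic.norm_p]; field_simp
  have h0 := aux_G μ hμ e he he1 he2 0
  simp [auxB] at h0
  refine ⟨fun h => ?_, fun h => ?_, fun h => ?_⟩
  · have h2 : ‖t / p‖ ≤ 1 := by
      rw [aux_lt_one_iff] at h
      rw [hnorm]
      calc _ ≤ (p:ℝ) * (p:ℝ)⁻¹ := by gcongr
        _ = 1 := by field_simp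
    simp only [padicCondOp]
    rw [hI, aux_G_one μ e he1 t h.le, aux_G_one μ e he1 _ h2, auxB, if_pos h2, if_neg h.ne]
    push_cast
    ring
  · have h2 := aux_G_big μ hμ e he he1 he2 0 (t / p) (by rw [hnorm, h]; simp)
    simp only [padicCondOp]
    rw [hI, aux_G_one μ e he1 t h.le, auxB, if_neg (c := ‖t / (p:ℚ_[p])‖ ≤ 1) (by rw [hnorm, h]; linarith), h]
    simp
    apply mul_left_cancel₀ hpc1
    simp at h2
    linear_combination h0 - h2
  · have ht0 : t ≠ 0 := by rintro rfl; simp at h; linarith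
    obtain ⟨n, hn⟩ : ∃ n : ℕ, ‖t‖ = (p:ℝ) ^ (n+1) := by
      have hv := Padic.norm_eq_zpow_neg_valuation ht0
      have : 0 < -t.valuation := by
        by_contra h5; push Not at h5
        have := zpow_le_one_of_nonpos₀ hp1.le h5
        linarith
      obtain ⟨m, hm⟩ := Int.eq_succ_of_zero_lt this
      refine ⟨m, ?_⟩
      rw [hv, hm, ← zpow_natCast]; push_cast; rfl
    have g1 := aux_G_big μ hμ e he he1 he2 n t hn
    have g2 := aux_G_big μ hμ e he he1 he2 (n+1) (t / p) (by rw [hnorm, hn]; ring)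
    simp only [padicCondOp]
    rw [hI, auxB, if_neg h.ne', if_neg, hn]
    · push_cast
      rw [eq_div_iff (pow_ne_zero _ hpc)]
      apply mul_left_cancel₀ hpc1
      push_cast at g1 g2
      linear_combination p * g1 - g2
    · rw [hnorm]; nlinarith
end

section
/- Let x > 1 be a real number and let g : ℝ → ℂ be smooth with compact support contained in (0,∞). Set Λ_x(s) = log(x)·x^{−s}/(1 − x^{−s}). Then the function τ ↦ ĝ(−1 + iτ)·Λ_x(−1 + iτ) is integrable on ℝ and (1/2π)·∫_ℝ ĝ(−1 + iτ)·Λ_x(−1 + iτ) dτ = −log(x)·g(1) − log(x)·∑_{k ≥ 1} g(x^{−k}), where the sum on the right has only finitely many nonzero terms. -/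
open MeasureTheory Complex

/-- Mellin transform: `ĝ(s) = ∫_0^∞ g(u)·u^s du/u`. -/
noncomputable def mellinT (g : ℝ → ℂ) (s : ℂ) : ℂ :=
  ∫ u in Set.Ioi (0 : ℝ), g u * (u : ℂ) ^ s / (u : ℂ)

/-- `Λ_x(s) = log(x)·x^{−s}/(1 − x^{−s})`. -/
noncomputable def LambdaX (x : ℝ) (s : ℂ) : ℂ :=
  (Real.log x : ℂ) * (x : ℂ) ^ (-s) / (1 - (x : ℂ) ^ (-s))

lemma aux_integrable_s16 (g : ℝ → ℂ) (hg : ContDiff ℝ (⊤ : ℕ∞) g) (hc : HasCompactSupport g)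
    (hsupp : tsupport g ⊆ Set.Ioi 0) :
    Integrable (fun τ : ℝ => mellin g (-1 + (τ : ℂ) * Complex.I)) := by
  let h : ℝ → ℂ := fun u => (Real.exp u) • g (Real.exp (-u))
  have hs : ContDiff ℝ (⊤ : ℕ∞) h := by
    have h1 : ContDiff ℝ (⊤ : ℕ∞) (fun u : ℝ => g (Real.exp (-u))) :=
      hg.comp (Real.contDiff_exp.comp contDiff_neg)
    exact Real.contDiff_exp.smul h1
  have hcs : HasCompactSupport h := by
    have hK : IsCompact ((fun u => -Real.log u) '' tsupport g) := by
      refine IsCompact.image_of_continuousOn hc ?_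
      refine (Real.continuousOn_log.mono ?_).neg
      intro u hu
      exact (ne_of_gt (hsupp hu) : u ≠ 0)
    refine HasCompactSupport.intro hK ?_
    intro u hu
    have : Real.exp (-u) ∉ tsupport g := by
      intro hm
      exact hu ⟨_, hm, by simp⟩
    simp [h, image_eq_zero_of_notMem_tsupport this]
  let S : SchwartzMap ℝ ℂ := hcs.toSchwartzMap hs
  have hS : Integrable (FourierTransform.fourier S : SchwartzMap ℝ ℂ) :=
    (FourierTransform.fourier S).integrable
  have := hS.comp_div (R := 2 * Real.pi) (by positivity)
  refine this.congr (Filter.Eventually.of_forall fun τ => ?_)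
  beta_reduce
  rw [mellin_eq_fourier]
  simp only [SchwartzMap.fourier_coe]
  have e1 : (fun u : ℝ => Real.exp (-(-1 + (τ : ℂ) * I).re * u) • g (Real.exp (-u))) = ⇑S := by
    funext u
    simp [S, h]
  have e2 : (-1 + (τ : ℂ) * I).im = τ := by simp
  rw [e1, e2]

lemma aux_conv (g : ℝ → ℂ) (hg : Continuous g) (hc : HasCompactSupport g)
    (hsupp : tsupport g ⊆ Set.Ioi 0) (s : ℂ) : MellinConvergent g s := by
  have h1 : IntegrableOn (fun t : ℝ => (t : ℂ) ^ (s - 1) • g t) (tsupport g) := by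
    refine ContinuousOn.integrableOn_compact hc ?_
    simp only [smul_eq_mul]
    refine ContinuousOn.mul ?_ hg.continuousOn
    intro t ht
    have h0 : 0 < t := hsupp ht
    exact ((continuousAt_ofReal_cpow_const t _ (Or.inr h0.ne')).continuousWithinAt)
  refine IntegrableOn.of_forall_sdiff_eq_zero h1 measurableSet_Ioi ?_
  intro t ht
  simp [image_eq_zero_of_notMem_tsupport ht.2]

lemma mellinT_eq (g : ℝ → ℂ) (s : ℂ) : mellinT g s = mellin g s := by
  unfold mellinT mellin
  refine setIntegral_congr_fun measurableSet_Ioi ?_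
  intro u hu
  have : (u : ℂ) ≠ 0 := by exact_mod_cast (ne_of_gt hu)
  simp only [smul_eq_mul]
  rw [Complex.cpow_sub _ _ this, Complex.cpow_one]
  ring

lemma aux_finite (x : ℝ) (hx : 1 < x) (g : ℝ → ℂ) (hsupp : tsupport g ⊆ Set.Ioi 0) :
    {k : ℕ | g (x ^ (-(k + 1 : ℤ))) ≠ 0}.Finite := by
  have h0 : (0 : ℝ) ∉ tsupport g := fun h => lt_irrefl (0 : ℝ) (Set.mem_Ioi.mp (hsupp h))
  have hev : ∀ᶠ y in nhds (0 : ℝ), g y = 0 := by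
    filter_upwards [(isClosed_tsupport g).isOpen_compl.mem_nhds h0] with y hy
    exact image_eq_zero_of_notMem_tsupport hy
  have ht : Filter.Tendsto (fun k : ℕ => x ^ (-(k + 1 : ℤ))) Filter.atTop (nhds 0) := by
    have := (tendsto_pow_atTop_nhds_zero_of_lt_one (r := x⁻¹) (by positivity)
      (inv_lt_one_of_one_lt₀ hx)).comp (Filter.tendsto_add_atTop_nat 1)
    refine this.congr fun k => ?_
    simp only [Function.comp]
    rw [zpow_neg, inv_pow]
    norm_cast
  have h2 := ht.eventually hev
  rw [← Nat.cofinite_eq_atTop, Filter.eventually_cofinite] at h2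
  exact h2

lemma aux_inv (x : ℝ) (hx : 1 < x) (g : ℝ → ℂ) (hg : ContDiff ℝ (⊤ : ℕ∞) g)
    (hc : HasCompactSupport g) (hsupp : tsupport g ⊆ Set.Ioi 0) (k : ℕ) :
    ∫ τ : ℝ, mellin g (-1 + (τ : ℂ) * Complex.I) * ((x : ℂ) ^ (-1 + (τ : ℂ) * Complex.I)) ^ k
      = 2 * (Real.pi : ℂ) * g ((x ^ k)⁻¹) := by
  have hx0 : 0 < x := by linarith
  have hy : 0 < (x ^ k)⁻¹ := by positivity
  have h := mellinInv_mellin_eq (-1) g hy (aux_conv g hg.continuous hc hsupp _)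
    (by simpa [Complex.VerticalIntegrable] using aux_integrable_s16 g hg hc hsupp)
    hg.continuous.continuousAt
  rw [← h, mellinInv, real_smul, ← mul_assoc]
  have hpi : (Real.pi : ℂ) ≠ 0 := by exact_mod_cast Real.pi_ne_zero
  have : 2 * (Real.pi : ℂ) * ((1 / (2 * Real.pi) : ℝ) : ℂ) = 1 := by
    push_cast; field_simp
  rw [this, one_mul]
  congr 1
  funext τ
  rw [smul_eq_mul, mul_comm]
  push_cast
  congr 1
  have hxc : (x : ℂ) ≠ 0 := by exact_mod_cast hx0.ne'
  set s : ℂ := -1 + (τ : ℂ) * Complex.I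
  have e := Complex.cpow_mul_ofReal_nonneg hx0.le (k : ℝ) s
  have harg : ((x : ℂ) ^ k).arg ≠ Real.pi := by
    rw [← Complex.ofReal_pow, Complex.arg_ofReal_of_nonneg (by positivity)]
    exact Real.pi_ne_zero.symm
  rw [Complex.cpow_neg, Complex.inv_cpow _ _ harg, inv_inv, ← Complex.cpow_nat_mul]
  simpa using e

/-- For real `x > 1` and smooth `g` compactly supported in `(0,∞)`,
`τ ↦ ĝ(−1+iτ)·Λ_x(−1+iτ)` is integrable on `ℝ` and
`(1/2π)·∫_ℝ ĝ(−1+iτ)·Λ_x(−1+iτ) dτ = −log(x)·g(1) − log(x)·∑_{k ≥ 1} g(x^{−k})`,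
the sum on the right having only finitely many nonzero terms. -/
theorem lambda_integral_line_neg_one (x : ℝ) (hx : 1 < x)
    (g : ℝ → ℂ) (hg : ContDiff ℝ (⊤ : ℕ∞) g) (hc : HasCompactSupport g)
    (hsupp : tsupport g ⊆ Set.Ioi 0) :
    Integrable (fun τ : ℝ =>
      mellinT g (-1 + (τ : ℂ) * Complex.I) * LambdaX x (-1 + (τ : ℂ) * Complex.I)) ∧
    {k : ℕ | g (x ^ (-(k + 1 : ℤ))) ≠ 0}.Finite ∧
    (1 / (2 * (Real.pi : ℂ))) * (∫ τ : ℝ,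
        mellinT g (-1 + (τ : ℂ) * Complex.I) * LambdaX x (-1 + (τ : ℂ) * Complex.I)) =
      -(Real.log x : ℂ) * g 1 - (Real.log x : ℂ) * ∑' k : ℕ, g (x ^ (-(k + 1 : ℤ))) := by
  have hx0 : 0 < x := by linarith
  have hxc : (x : ℂ) ≠ 0 := by exact_mod_cast hx0.ne'
  have hF := aux_integrable_s16 g hg hc hsupp
  have hfin := aux_finite x hx g hsupp
  simp only [mellinT_eq]
  set F : ℝ → ℂ := fun τ => mellin g (-1 + (τ : ℂ) * Complex.I) with hFdef
  let q : ℝ → ℂ := fun τ => (x : ℂ) ^ (-1 + (τ : ℂ) * Complex.I)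
  have hq : ∀ τ, ‖q τ‖ = x⁻¹ := by
    intro τ
    simp [q, Complex.norm_cpow_eq_rpow_re_of_pos hx0, Real.rpow_neg_one]
  have hx1 : x⁻¹ < 1 := inv_lt_one_of_one_lt₀ hx
  have hqc : Continuous q := by
    refine Continuous.const_cpow (by fun_prop) (Or.inl hxc)
  have hL : ∀ τ : ℝ, LambdaX x (-1 + (τ : ℂ) * Complex.I) = -(Real.log x : ℂ) * (1 - q τ)⁻¹ := by
    intro τ
    have h0 : q τ ≠ 0 := by
      rw [← norm_ne_zero_iff, hq]; positivity
    have h1 : q τ ≠ 1 := by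
      intro h
      have := hq τ
      rw [h, norm_one] at this
      linarith
    have h2 : 1 - q τ ≠ 0 := sub_ne_zero.mpr h1.symm
    have h3 : q τ - 1 ≠ 0 := sub_ne_zero.mpr h1
    have h4 : 1 - (q τ)⁻¹ ≠ 0 := by
      intro h
      apply h1
      rw [sub_eq_zero] at h
      exact (inv_eq_one.mp h.symm)
    unfold LambdaX
    rw [Complex.cpow_neg]
    change (Real.log x : ℂ) * (q τ)⁻¹ / (1 - (q τ)⁻¹) = _
    rw [div_eq_iff h4]
    field_simp
    ring
  let G : ℕ → ℝ → ℂ := fun k τ => -(Real.log x : ℂ) * (F τ * q τ ^ k)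
  have hGn : ∀ k τ, ‖G k τ‖ = Real.log x * x⁻¹ ^ k * ‖F τ‖ := by
    intro k τ
    simp only [G, norm_mul, norm_neg, norm_pow, hq, Complex.norm_real, Real.norm_eq_abs,
      abs_of_pos (Real.log_pos hx)]
    ring
  have hGi : ∀ k, Integrable (G k) := by
    intro k
    refine Integrable.mono' (hF.norm.const_mul (Real.log x * x⁻¹ ^ k)) ?_
      (Filter.Eventually.of_forall fun τ => (hGn k τ).le)
    exact (hF.aestronglyMeasurable.mul (hqc.pow k).aestronglyMeasurable).const_mul _
  have hsum : Summable fun k => ∫ τ, ‖G k τ‖ := by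
    simp only [hGn, integral_const_mul]
    exact ((summable_geometric_of_lt_one (by positivity) hx1).mul_left _).mul_right _
  have hts : ∀ τ : ℝ, HasSum (fun k => G k τ)
      (F τ * LambdaX x (-1 + (τ : ℂ) * Complex.I)) := by
    intro τ
    rw [hL]
    have := ((hasSum_geometric_of_norm_lt_one (ξ := q τ) (by rw [hq]; exact hx1)).mul_left
      (F τ)).mul_left (-(Real.log x : ℂ))
    rw [show F τ * (-(Real.log x : ℂ) * (1 - q τ)⁻¹) = -(Real.log x : ℂ) * (F τ * (1 - q τ)⁻¹) by ring]
    exact this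
  have hI := hasSum_integral_of_summable_integral_norm hGi hsum
  have hpi : (Real.pi : ℂ) ≠ 0 := by exact_mod_cast Real.pi_ne_zero
  refine ⟨?_, hfin, ?_⟩
  · have hb : ∀ τ : ℝ, ‖(1 - q τ)⁻¹‖ ≤ (1 - x⁻¹)⁻¹ := by
      intro τ
      rw [norm_inv]
      have := norm_sub_norm_le (1 : ℂ) (q τ)
      rw [hq, norm_one] at this
      exact inv_anti₀ (by linarith) this
    simp only [hL]
    refine hF.mul_bdd (c := Real.log x * (1 - x⁻¹)⁻¹) ?_ (Filter.Eventually.of_forall fun τ => ?_)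
    · exact ((measurable_const.sub hqc.measurable).inv.const_mul _).aestronglyMeasurable
    · rw [norm_mul, norm_neg, Complex.norm_real, Real.norm_eq_abs, abs_of_pos (Real.log_pos hx)]
      exact mul_le_mul_of_nonneg_left (hb τ) (Real.log_pos hx).le
  · have hE : ∀ k, ∫ τ, G k τ = -(Real.log x : ℂ) * (2 * (Real.pi : ℂ) * g ((x ^ k)⁻¹)) := by
      intro k
      simp only [G, integral_const_mul]
      rw [← aux_inv x hx g hg hc hsupp k]
    simp only [fun τ => (hts τ).tsum_eq, hE] at hI
    have hS : Summable fun k : ℕ => g ((x ^ k)⁻¹) := by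
      rw [← summable_nat_add_iff 1]
      refine summable_of_hasFiniteSupport (hfin.subset ?_)
      intro k hk
      have e : x ^ (-(k + 1 : ℤ)) = (x ^ (k + 1))⁻¹ := by
        rw [zpow_neg]; norm_cast
      rw [Set.mem_ofPred_eq, e]
      exact hk
    have hT := hI.tsum_eq
    rw [tsum_mul_left, tsum_mul_left, hS.tsum_eq_zero_add] at hT
    rw [← hT]
    have e : ∀ k : ℕ, x ^ (-(k + 1 : ℤ)) = (x ^ (k + 1))⁻¹ := by
      intro k
      rw [zpow_neg]; norm_cast
    simp only [e]
    field_simp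
    simp
    ring
end
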